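/- arXiv:1502.00326 — 8 statements merged into one kernel-verified Lean document; each statement's English description precedes it below -/
import Mathlib

section
/- There exist universal constants H_0 > 0 and 0 < c ≤ C < ∞ such that for all integers S ≥ 2, n ≥ 2 and all H with H_0 ≤ H ≤ ln S, the maximum squared L2 risk of the plug-in entropy estimator satisfies: if S ln S ≤ e·n·H then c[(S/n)² + H ln S / n] ≤ sup_{P ∈ M_S(H)} E_P |H(P_n) − H(P)|² ≤ C[(S/n)² + H ln S / n], while if S ln S > e·n·H then c[(H/ln S)·ln(S ln S/(nH))]² ≤ sup_{P ∈ M_S(H)} E_P |H(P_n) − H(P)|² ≤ C[(H/ln S)·ln(S ln S/(nH))]². -/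
open scoped BigOperators

/-- Shannon entropy of a vector `p : Fin S → ℝ` (with the convention `0 ln 0 = 0`,
which holds automatically since `Real.log 0 = 0`). -/
noncomputable def entropy {S : ℕ} (p : Fin S → ℝ) : ℝ := ∑ i, -(p i * Real.log (p i))

/-- `p` is a discrete probability distribution on `S` symbols. -/
def IsDist {S : ℕ} (p : Fin S → ℝ) : Prop := (∀ i, 0 ≤ p i) ∧ ∑ i, p i = 1

/-- The empirical distribution of the sample `x` of size `n`. -/
noncomputable def empDist {S n : ℕ} (x : Fin n → Fin S) : Fin S → ℝ :=
  fun i => ((Finset.univ.filter (fun j => x j = i)).card : ℝ) / n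

/-- Probability of observing the i.i.d. sample sequence `x` under `p`. -/
noncomputable def multProb {S n : ℕ} (p : Fin S → ℝ) (x : Fin n → Fin S) : ℝ :=
  ∏ j, p (x j)

/-- Squared L2 risk of the plug-in (MLE) entropy estimator at `p`, with `n` i.i.d. samples. -/
noncomputable def mleRisk (S n : ℕ) (p : Fin S → ℝ) : ℝ :=
  ∑ x : Fin n → Fin S, multProb p x * (entropy (empDist x) - entropy p) ^ 2

/-- Maximum risk of the plug-in estimator over `M_S(H) = {p : IsDist p, entropy p ≤ H}`. -/
noncomputable def mleSupRisk (S n : ℕ) (H : ℝ) : ℝ :=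
  sSup { r | ∃ p : Fin S → ℝ, IsDist p ∧ entropy p ≤ H ∧ r = mleRisk S n p }

/-- Expectation of `F` under `n` i.i.d. samples from `p`. -/
noncomputable def sampleMean {S n : ℕ} (p : Fin S → ℝ) (F : (Fin n → Fin S) → ℝ) : ℝ :=
  ∑ x, multProb p x * F x

namespace sampleMean

variable {S n : ℕ} {p : Fin S → ℝ}

lemma succ (p : Fin S → ℝ) (F : (Fin (n + 1) → Fin S) → ℝ) :
    sampleMean p F = ∑ a, p a * sampleMean p (fun x => F (Fin.cons a x)) := by
  unfold sampleMean
  rw [← (Fin.consEquiv (fun _ : Fin (n + 1) => Fin S)).sum_comp, Fintype.sum_prod_type]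
  refine Finset.sum_congr rfl fun a _ => ?_
  rw [Finset.mul_sum]
  refine Finset.sum_congr rfl fun x _ => ?_
  simp [multProb, Fin.prod_univ_succ, Fin.consEquiv, mul_assoc]

lemma add (F G : (Fin n → Fin S) → ℝ) :
    sampleMean p (fun x => F x + G x) = sampleMean p F + sampleMean p G := by
  simp [sampleMean, mul_add, Finset.sum_add_distrib]

lemma sub (F G : (Fin n → Fin S) → ℝ) :
    sampleMean p (fun x => F x - G x) = sampleMean p F - sampleMean p G := by
  simp [sampleMean, mul_sub, Finset.sum_sub_distrib]

lemma const_mul (c : ℝ) (F : (Fin n → Fin S) → ℝ) :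
    sampleMean p (fun x => c * F x) = c * sampleMean p F := by
  simp only [sampleMean, Finset.mul_sum]
  exact Finset.sum_congr rfl fun x _ => by ring

lemma sum {ι : Type*} (s : Finset ι) (F : ι → (Fin n → Fin S) → ℝ) :
    sampleMean p (fun x => ∑ i ∈ s, F i x) = ∑ i ∈ s, sampleMean p (F i) := by
  simp only [sampleMean, Finset.mul_sum]
  exact Finset.sum_comm

lemma const (hp : IsDist p) (c : ℝ) : sampleMean p (fun _ : Fin n → Fin S => c) = c := by
  induction n with
  | zero => simp [sampleMean, multProb]
  | succ n ih => rw [succ]; simp only [ih]; rw [← Finset.sum_mul, hp.2, one_mul]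

lemma mono (hp : IsDist p) {F G : (Fin n → Fin S) → ℝ} (h : ∀ x, F x ≤ G x) :
    sampleMean p F ≤ sampleMean p G :=
  Finset.sum_le_sum fun x _ =>
    mul_le_mul_of_nonneg_left (h x) (Finset.prod_nonneg fun j _ => hp.1 (x j))

lemma sq_sub_const (hp : IsDist p) (F : (Fin n → Fin S) → ℝ) (c : ℝ) :
    sampleMean p (fun x => (F x - c) ^ 2) =
      sampleMean p (fun x => (F x - sampleMean p F) ^ 2) + (sampleMean p F - c) ^ 2 := by
  have key : ∀ d : ℝ, sampleMean p (fun x => (F x - d) ^ 2) =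
      sampleMean p (fun x => F x ^ 2) - 2 * d * sampleMean p F + d ^ 2 := by
    intro d
    have : (fun x => (F x - d) ^ 2) = fun x => (F x ^ 2 - (2 * d) * F x) + d ^ 2 := by
      ext x; ring
    rw [this, add, sub, const_mul, const hp]
  rw [key, key]; ring

lemma sq_le (hp : IsDist p) (F : (Fin n → Fin S) → ℝ) :
    sampleMean p F ^ 2 ≤ sampleMean p (fun x => F x ^ 2) := by
  have h := sq_sub_const hp F 0
  have h0 : 0 ≤ sampleMean p (fun x => (F x - sampleMean p F) ^ 2) := by
    simpa [const hp] using mono (p := p) hp (F := fun _ => 0) fun x => sq_nonneg (F x - sampleMean p F)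
  simp only [sub_zero] at h
  linarith

end sampleMean

open sampleMean in
/-- The Efron–Stein inequality: each `G j` is a proxy for `F` that ignores the `j`-th sample. -/
lemma efron_stein {S n : ℕ} {p : Fin S → ℝ} (hp : IsDist p) (F : (Fin n → Fin S) → ℝ)
    (G : Fin n → (Fin n → Fin S) → ℝ)
    (hG : ∀ j x a, G j (Function.update x j a) = G j x) :
    sampleMean p (fun x => (F x - sampleMean p F) ^ 2) ≤
      ∑ j, sampleMean p (fun x => (F x - G j x) ^ 2) := by
  induction n with
  | zero => simp [sampleMean, multProb]
  | succ n ih =>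
    set e := sampleMean p F with he
    obtain ⟨b⟩ : Nonempty (Fin S) := by
      by_contra hne
      rw [not_nonempty_iff] at hne
      simpa using hp.2
    have hG0 : ∀ a x, G 0 (Fin.cons a x) = G 0 (Fin.cons b x) := by
      intro a x
      rw [← hG 0 (Fin.cons b x) a, Fin.update_cons_zero]
    set g := sampleMean p (fun x => G 0 (Fin.cons b x)) with hg
    have he' : e = ∑ a, p a * sampleMean p (fun x => F (Fin.cons a x)) := succ p F
    have h1 : ∀ a, sampleMean p (fun x => (F (Fin.cons a x) - e) ^ 2) ≤
        (∑ j : Fin n, sampleMean p (fun x => (F (Fin.cons a x) - G j.succ (Fin.cons a x)) ^ 2))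
        + (sampleMean p (fun x => F (Fin.cons a x)) - e) ^ 2 := by
      intro a
      rw [sq_sub_const hp]
      gcongr
      refine ih (fun x => F (Fin.cons a x)) (fun j x => G j.succ (Fin.cons a x)) ?_
      intro j x c
      rw [← hG j.succ (Fin.cons a x) c, Fin.cons_update]
    have h2 : ∑ a, p a * (sampleMean p (fun x => F (Fin.cons a x)) - e) ^ 2 ≤
        ∑ a, p a * (sampleMean p (fun x => F (Fin.cons a x)) - g) ^ 2 := by
      have : ∑ a, p a * (sampleMean p (fun x => F (Fin.cons a x)) - g) ^ 2 =
          ∑ a, p a * (sampleMean p (fun x => F (Fin.cons a x)) - e) ^ 2 + (e - g) ^ 2 := by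
        have h3 : ∀ a, p a * (sampleMean p (fun x => F (Fin.cons a x)) - g) ^ 2 =
            p a * (sampleMean p (fun x => F (Fin.cons a x)) - e) ^ 2 +
            (2 * (e - g)) * (p a * sampleMean p (fun x => F (Fin.cons a x))) +
            (g ^ 2 - e ^ 2) * p a := by
          intro a; ring
        simp_rw [h3, Finset.sum_add_distrib, ← Finset.mul_sum, hp.2, ← he']
        ring
      nlinarith [sq_nonneg (e - g)]
    have h4 : ∀ a, (sampleMean p (fun x => F (Fin.cons a x)) - g) ^ 2 ≤
        sampleMean p (fun x => (F (Fin.cons a x) - G 0 (Fin.cons a x)) ^ 2) := by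
      intro a
      rw [hg, ← sub]
      simp_rw [hG0 a]
      exact sq_le hp _
    rw [succ, Fin.sum_univ_succ]
    calc ∑ a, p a * sampleMean p (fun x => (F (Fin.cons a x) - e) ^ 2)
        ≤ ∑ a, (p a * (∑ j : Fin n,
            sampleMean p (fun x => (F (Fin.cons a x) - G j.succ (Fin.cons a x)) ^ 2)) +
            p a * (sampleMean p (fun x => F (Fin.cons a x)) - e) ^ 2) := by
          refine Finset.sum_le_sum fun a _ => ?_
          rw [← mul_add]
          exact mul_le_mul_of_nonneg_left (h1 a) (hp.1 a)
      _ ≤ ∑ j : Fin n, sampleMean p (fun x => (F x - G j.succ x) ^ 2) +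
            ∑ a, p a * sampleMean p (fun x => (F (Fin.cons a x) - G 0 (Fin.cons a x)) ^ 2) := by
          rw [Finset.sum_add_distrib]
          refine add_le_add (le_of_eq ?_) (h2.trans ?_)
          · simp_rw [succ p (n := n), Finset.mul_sum]
            exact Finset.sum_comm
          · exact Finset.sum_le_sum fun a _ => mul_le_mul_of_nonneg_left (h4 a) (hp.1 a)
      _ = _ := by rw [add_comm, succ p (fun x => (F x - G 0 x) ^ 2)]

/-- The number of occurrences of the symbol `i` in the sample `x`. -/
noncomputable def symbolCount {S n : ℕ} (x : Fin n → Fin S) (i : Fin S) : ℝ :=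
  ∑ j, if x j = i then 1 else 0

lemma empDist_eq {S n : ℕ} (x : Fin n → Fin S) (i : Fin S) :
    empDist x i = symbolCount x i / n := by
  simp [empDist, symbolCount]

lemma symbolCount_cons {S n : ℕ} (a : Fin S) (x : Fin n → Fin S) (i : Fin S) :
    symbolCount (Fin.cons a x : Fin (n + 1) → Fin S) i
      = (if a = i then 1 else 0) + symbolCount x i := by
  unfold symbolCount
  rw [Fin.sum_univ_succ]
  simp only [Fin.cons_zero, Fin.cons_succ]

lemma symbolCount_eq_zero_or_one_le {S n : ℕ} (x : Fin n → Fin S) (i : Fin S) :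
    symbolCount x i = 0 ∨ 1 ≤ symbolCount x i := by
  have h : symbolCount x i = ((Finset.univ.filter (fun j => x j = i)).card : ℝ) := by
    simp [symbolCount]
  rw [h]
  rcases Nat.eq_zero_or_pos (Finset.univ.filter (fun j => x j = i)).card with h | h
  · left; exact_mod_cast h
  · right; exact_mod_cast h

lemma symbolCount_nonneg {S n : ℕ} (x : Fin n → Fin S) (i : Fin S) : 0 ≤ symbolCount x i := by
  rcases symbolCount_eq_zero_or_one_le x i with h | h <;> linarith

lemma sum_apply_eq_sum_symbolCount {S n : ℕ} (x : Fin n → Fin S) (f : Fin S → ℝ) :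
    ∑ j, f (x j) = ∑ i, symbolCount x i * f i := by
  simp only [symbolCount, Finset.sum_mul]
  rw [Finset.sum_comm]
  simp

lemma sum_symbolCount {S n : ℕ} (x : Fin n → Fin S) : ∑ i, symbolCount x i = n := by
  simpa using (sum_apply_eq_sum_symbolCount x (fun _ => 1)).symm

lemma isDist_empDist {S n : ℕ} (hn : 0 < n) (x : Fin n → Fin S) : IsDist (empDist x) := by
  constructor
  · intro i; rw [empDist_eq]; exact div_nonneg (symbolCount_nonneg x i) (by positivity)
  · simp_rw [empDist_eq]
    rw [← Finset.sum_div, sum_symbolCount, div_self (by positivity)]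

lemma IsDist.le_one {S : ℕ} {p : Fin S → ℝ} (hp : IsDist p) (i : Fin S) : p i ≤ 1 := by
  rw [← hp.2]
  exact Finset.single_le_sum (fun j _ => hp.1 j) (Finset.mem_univ i)

lemma entropy_eq {S : ℕ} (p : Fin S → ℝ) : entropy p = ∑ i, Real.negMulLog (p i) := by
  simp [entropy, Real.negMulLog]

lemma IsDist.entropy_nonneg {S : ℕ} {p : Fin S → ℝ} (hp : IsDist p) : 0 ≤ entropy p := by
  rw [entropy_eq]
  exact Finset.sum_nonneg fun i _ => Real.negMulLog_nonneg (hp.1 i) (hp.le_one i)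

section moments

variable {S : ℕ} {p : Fin S → ℝ}

open sampleMean

lemma sampleMean_symbolCount_succ (hp : IsDist p) (n : ℕ) (i : Fin S) (f : ℝ → ℝ) :
    sampleMean p (fun x : Fin (n + 1) → Fin S => f (symbolCount x i)) =
      p i * sampleMean p (fun x : Fin n → Fin S => f (1 + symbolCount x i)) +
      (1 - p i) * sampleMean p (fun x : Fin n → Fin S => f (symbolCount x i)) := by
  rw [succ]
  simp_rw [symbolCount_cons]
  rw [← hp.2, ← Finset.add_sum_erase _ _ (Finset.mem_univ i),
    ← Finset.add_sum_erase _ p (Finset.mem_univ i), add_sub_cancel_left, Finset.sum_mul]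
  congr 1
  · simp
  · refine Finset.sum_congr rfl fun a ha => ?_
    simp [Finset.ne_of_mem_erase ha]

lemma sampleMean_symbolCount (hp : IsDist p) (n : ℕ) (i : Fin S) :
    sampleMean p (fun x : Fin n → Fin S => symbolCount x i) = n * p i := by
  induction n with
  | zero => simp [sampleMean, symbolCount]
  | succ n ih =>
    rw [sampleMean_symbolCount_succ hp n i (fun k => k), add, const hp, ih]
    push_cast; ring

lemma sampleMean_symbolCount_sq (hp : IsDist p) (n : ℕ) (i : Fin S) :
    sampleMean p (fun x : Fin n → Fin S => symbolCount x i ^ 2) =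
      n * p i + n * (n - 1) * p i ^ 2 := by
  induction n with
  | zero => simp [sampleMean, symbolCount]
  | succ n ih =>
    rw [sampleMean_symbolCount_succ hp n i (fun k => k ^ 2)]
    have : (fun x : Fin n → Fin S => (1 + symbolCount x i) ^ 2) =
        fun x => (1 + 2 * symbolCount x i) + symbolCount x i ^ 2 := by ext x; ring
    rw [this, add, add, const_mul, const hp, ih, sampleMean_symbolCount hp]
    push_cast; ring

lemma sampleMean_symbolCount_cube (hp : IsDist p) (n : ℕ) (i : Fin S) :
    sampleMean p (fun x : Fin n → Fin S => symbolCount x i ^ 3) =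
      n * p i + 3 * n * (n - 1) * p i ^ 2 + n * (n - 1) * (n - 2) * p i ^ 3 := by
  induction n with
  | zero => simp [sampleMean, symbolCount]
  | succ n ih =>
    rw [sampleMean_symbolCount_succ hp n i (fun k => k ^ 3)]
    have : (fun x : Fin n → Fin S => (1 + symbolCount x i) ^ 3) =
        fun x => ((1 + 3 * symbolCount x i) + 3 * symbolCount x i ^ 2) + symbolCount x i ^ 3 := by
      ext x; ring
    rw [this, add, add, add, const_mul, const_mul, const hp, ih, sampleMean_symbolCount hp,
      sampleMean_symbolCount_sq hp]
    push_cast; ring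

end moments

section empirical

variable {S n : ℕ} {p : Fin S → ℝ}

open sampleMean

lemma sampleMean_empDist (hp : IsDist p) (hn : 0 < n) (i : Fin S) :
    sampleMean p (fun x : Fin n → Fin S => empDist x i) = p i := by
  have h : (fun x : Fin n → Fin S => empDist x i) =
      fun x => (n : ℝ)⁻¹ * symbolCount x i := by
    ext x; rw [empDist_eq]; ring
  have : (n : ℝ) ≠ 0 := by positivity
  rw [h, const_mul, sampleMean_symbolCount hp]
  field_simp

lemma sampleMean_empDist_sq (hp : IsDist p) (hn : 0 < n) (i : Fin S) :
    sampleMean p (fun x : Fin n → Fin S => empDist x i ^ 2) =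
      p i ^ 2 + p i * (1 - p i) / n := by
  have h : (fun x : Fin n → Fin S => empDist x i ^ 2) =
      fun x => ((n : ℝ) ^ 2)⁻¹ * symbolCount x i ^ 2 := by
    ext x; rw [empDist_eq]; ring
  have : (n : ℝ) ≠ 0 := by positivity
  rw [h, const_mul, sampleMean_symbolCount_sq hp]
  field_simp; ring

lemma sampleMean_empDist_cube (hp : IsDist p) (hn : 0 < n) (i : Fin S) :
    sampleMean p (fun x : Fin n → Fin S => empDist x i ^ 3) =
      p i / n ^ 2 + 3 * (n - 1) * p i ^ 2 / n ^ 2 + (n - 1) * (n - 2) * p i ^ 3 / n ^ 2 := by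
  have h : (fun x : Fin n → Fin S => empDist x i ^ 3) =
      fun x => ((n : ℝ) ^ 3)⁻¹ * symbolCount x i ^ 3 := by
    ext x; rw [empDist_eq]; ring
  have : (n : ℝ) ≠ 0 := by positivity
  rw [h, const_mul, sampleMean_symbolCount_cube hp]
  field_simp

/-- The contribution of the symbol `i` to the bias of the plug-in entropy estimator. -/
noncomputable def symbolBias (n : ℕ) (p : Fin S → ℝ) (i : Fin S) : ℝ :=
  Real.negMulLog (p i) - sampleMean p (fun x : Fin n → Fin S => Real.negMulLog (empDist x i))

lemma entropy_sub_sampleMean (n : ℕ) (p : Fin S → ℝ) :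
    entropy p - sampleMean p (fun x : Fin n → Fin S => entropy (empDist x)) =
      ∑ i, symbolBias n p i := by
  simp_rw [entropy_eq]
  rw [sampleMean.sum, ← Finset.sum_sub_distrib]
  rfl

lemma empDist_eq_zero_or_inv_le (hn : 0 < n) (x : Fin n → Fin S) (i : Fin S) :
    empDist x i = 0 ∨ (n : ℝ)⁻¹ ≤ empDist x i := by
  rw [empDist_eq]
  rcases symbolCount_eq_zero_or_one_le x i with h | h
  · left; simp [h]
  · right; rw [inv_eq_one_div]; gcongr

lemma negMulLog_empDist_le (hn : 0 < n) (x : Fin n → Fin S) (i : Fin S) :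
    Real.negMulLog (empDist x i) ≤ Real.log n * empDist x i := by
  rcases empDist_eq_zero_or_inv_le hn x i with h | h
  · simp [h]
  · have hn' : (0 : ℝ) < (n : ℝ)⁻¹ := by positivity
    have h1 := Real.log_le_log hn' h
    rw [Real.log_inv] at h1
    rw [Real.negMulLog]
    nlinarith

lemma symbolBias_ge_log (hp : IsDist p) (hn : 0 < n) (i : Fin S) :
    Real.negMulLog (p i) - p i * Real.log n ≤ symbolBias n p i := by
  have h := sampleMean.mono hp fun x : Fin n → Fin S => negMulLog_empDist_le hn x i
  rw [const_mul, sampleMean_empDist hp hn] at h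
  unfold symbolBias
  linarith

/-- The tangent line bound for `q ↦ q log q` at `r`. -/
lemma negMulLog_le_tangent {q r : ℝ} (hq : 0 ≤ q) (hr : 0 < r) :
    Real.negMulLog q ≤ -q * Real.log r - (q - r) := by
  rcases hq.eq_or_lt with rfl | hq
  · simp [hr.le]
  · have h := Real.log_le_sub_one_of_pos (div_pos hr hq)
    rw [Real.log_div hr.ne' hq.ne'] at h
    have h2 := mul_le_mul_of_nonneg_left h hq.le
    have : q * (r / q - 1) = r - q := by field_simp
    rw [Real.negMulLog]
    linarith

lemma symbolBias_nonneg (hp : IsDist p) (hn : 0 < n) (i : Fin S) : 0 ≤ symbolBias n p i := by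
  rcases (hp.1 i).eq_or_lt with h | h
  · simpa [← h] using symbolBias_ge_log hp hn i
  · have h1 := sampleMean.mono hp fun x : Fin n → Fin S =>
      (negMulLog_le_tangent ((isDist_empDist hn x).1 i) h).trans_eq
        (show _ = (-Real.log (p i) - 1) * empDist x i + p i by ring)
    rw [sampleMean.add, const_mul, sampleMean_empDist hp hn, const hp] at h1
    rw [symbolBias, Real.negMulLog]
    linarith

lemma symbolBias_le (hp : IsDist p) (hn : 0 < n) (i : Fin S) :
    symbolBias n p i ≤ p i * Real.log (1 + 1 / (n * p i)) := by
  rcases (hp.1 i).eq_or_lt with h | h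
  · have h1 := sampleMean.mono hp fun x : Fin n → Fin S =>
      Real.negMulLog_nonneg ((isDist_empDist hn x).1 i) ((isDist_empDist hn x).le_one i)
    rw [const hp] at h1
    simpa [symbolBias, ← h] using h1
  · have hn' : (0 : ℝ) < n := by positivity
    set a := 1 + 1 / (n * p i) with ha
    have ha0 : 0 < a := by positivity
    have h1 : ∀ x : Fin n → Fin S,
        (1 - Real.log (p i * a)) * empDist x i - (p i * a)⁻¹ * empDist x i ^ 2 ≤
          Real.negMulLog (empDist x i) := by
      intro x
      rcases ((isDist_empDist hn x).1 i).eq_or_lt with h0 | h0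
      · simp [← h0]
      · have h2 := Real.log_le_sub_one_of_pos (div_pos h0 (mul_pos h ha0))
        rw [Real.log_div h0.ne' (mul_pos h ha0).ne'] at h2
        have h3 := mul_le_mul_of_nonneg_left h2 h0.le
        have : empDist x i * (empDist x i / (p i * a) - 1) =
          (p i * a)⁻¹ * empDist x i ^ 2 - empDist x i := by ring
        rw [Real.negMulLog]
        linarith
    have h2 := sampleMean.mono hp h1
    rw [sampleMean.sub, const_mul, const_mul, sampleMean_empDist hp hn,
      sampleMean_empDist_sq hp hn, Real.log_mul h.ne' ha0.ne'] at h2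
    have h3 : (p i * a)⁻¹ * (p i ^ 2 + p i * (1 - p i) / n) ≤ p i := by
      rw [inv_mul_le_iff₀ (mul_pos h ha0), ha]
      have : p i * (1 + 1 / (n * p i)) * p i = p i ^ 2 + p i / n := by field_simp
      rw [this]
      gcongr
      nlinarith
    rw [symbolBias, Real.negMulLog]
    linarith

lemma mul_log_ge_cubic {x : ℝ} (hx : 0 ≤ x) :
    (x - 1) + (x - 1) ^ 2 / 2 - (x - 1) ^ 3 / 6 ≤ x * Real.log x := by
  rcases hx.eq_or_lt with rfl | hx
  · norm_num
  have hdg : ∀ y ∈ Set.Ioi (0 : ℝ),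
      HasDerivAt (fun y => Real.log y - (y - 1) + (y - 1) ^ 2 / 2) ((y - 1) ^ 2 / y) y := by
    intro y hy
    have hy' : y ≠ 0 := ne_of_gt hy
    have h := ((Real.hasDerivAt_log hy').sub ((hasDerivAt_id y).sub_const 1)).add
      ((((hasDerivAt_id y).sub_const 1).pow 2).div_const 2)
    refine h.congr_deriv ?_
    simp
    field_simp
    ring
  have hgm : MonotoneOn (fun y => Real.log y - (y - 1) + (y - 1) ^ 2 / 2) (Set.Ioi (0 : ℝ)) := by
    refine monotoneOn_of_deriv_nonneg (convex_Ioi 0)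
      (fun y hy => (hdg y hy).continuousAt.continuousWithinAt)
      (fun y hy => ((hdg y (interior_subset hy)).differentiableAt).differentiableWithinAt) ?_
    intro y hy
    rw [(hdg y (interior_subset hy)).deriv]
    have : 0 < y := interior_subset hy
    positivity
  have hdf : ∀ y ∈ Set.Ioi (0 : ℝ),
      HasDerivAt (fun y => y * Real.log y - (y - 1) - (y - 1) ^ 2 / 2 + (y - 1) ^ 3 / 6)
        (Real.log y - (y - 1) + (y - 1) ^ 2 / 2) y := by
    intro y hy
    have hy' : y ≠ 0 := ne_of_gt hy
    have h := ((((hasDerivAt_id y).mul (Real.hasDerivAt_log hy')).sub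
      ((hasDerivAt_id y).sub_const 1)).sub
      ((((hasDerivAt_id y).sub_const 1).pow 2).div_const 2)).add
      ((((hasDerivAt_id y).sub_const 1).pow 3).div_const 6)
    refine h.congr_deriv ?_
    simp
    field_simp
    ring
  suffices h : (0 : ℝ) ≤ x * Real.log x - (x - 1) - (x - 1) ^ 2 / 2 + (x - 1) ^ 3 / 6 by linarith
  rcases le_total 1 x with h1 | h1
  · have : MonotoneOn (fun y => y * Real.log y - (y - 1) - (y - 1) ^ 2 / 2 + (y - 1) ^ 3 / 6)
        (Set.Ici (1 : ℝ)) := by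
      have hpos : ∀ y ∈ Set.Ici (1 : ℝ), y ∈ Set.Ioi (0 : ℝ) := fun y hy =>
        Set.mem_Ioi.2 (lt_of_lt_of_le one_pos (Set.mem_Ici.1 hy))
      refine monotoneOn_of_deriv_nonneg (convex_Ici 1)
        (fun y hy => (hdf y (hpos y hy)).continuousAt.continuousWithinAt)
        (fun y hy => ((hdf y (hpos y (interior_subset hy))).differentiableAt).differentiableWithinAt) ?_
      intro y hy
      have hy' := interior_subset hy
      rw [(hdf y (hpos y hy')).deriv]
      simpa using hgm (Set.mem_Ioi.2 one_pos) (hpos y hy') hy'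
    simpa using this (Set.mem_Ici.2 le_rfl) h1 h1
  · have : AntitoneOn (fun y => y * Real.log y - (y - 1) - (y - 1) ^ 2 / 2 + (y - 1) ^ 3 / 6)
        (Set.Ioc (0 : ℝ) 1) := by
      refine antitoneOn_of_deriv_nonpos (convex_Ioc 0 1)
        (fun y hy => (hdf y hy.1).continuousAt.continuousWithinAt)
        (fun y hy => ((hdf y (interior_subset hy).1).differentiableAt).differentiableWithinAt) ?_
      intro y hy
      have hy' := interior_subset hy
      rw [(hdf y hy'.1).deriv]
      simpa using hgm hy'.1 (Set.mem_Ioi.2 one_pos) hy'.2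
    simpa using this ⟨hx, h1⟩ ⟨one_pos, le_rfl⟩ h1

lemma symbolBias_ge_inv (hp : IsDist p) (hn : 0 < n) (i : Fin S) (h2 : p i ≤ 1 / 2)
    (h3 : 1 / 2 ≤ n * p i) : 1 / (12 * n) ≤ symbolBias n p i := by
  have hn' : (0 : ℝ) < n := by positivity
  have h : 0 < p i := by by_contra h; nlinarith
  have h1 : ∀ x : Fin n → Fin S, Real.negMulLog (empDist x i) ≤
      p i / 3 + (-Real.log (p i) + 1 / 2) * empDist x i + (-1 / p i) * empDist x i ^ 2 +
        (1 / (6 * p i ^ 2)) * empDist x i ^ 3 := by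
    intro x
    have hq := (isDist_empDist hn x).1 i
    have h4 := mul_le_mul_of_nonneg_left (mul_log_ge_cubic (div_nonneg hq h.le)) h.le
    have h5 : p i * (empDist x i / p i * Real.log (empDist x i / p i)) =
        - Real.negMulLog (empDist x i) - empDist x i * Real.log (p i) := by
      rcases hq.eq_or_lt with h0 | h0
      · simp [← h0]
      · rw [Real.log_div h0.ne' h.ne', Real.negMulLog]
        field_simp
    rw [h5] at h4
    have h6 : p i * (empDist x i / p i - 1 + (empDist x i / p i - 1) ^ 2 / 2 -
        (empDist x i / p i - 1) ^ 3 / 6) =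
        p i * (-1 / 3) - 1 / 2 * empDist x i + empDist x i ^ 2 / p i -
          empDist x i ^ 3 / (6 * p i ^ 2) := by
      field_simp
      ring
    rw [h6] at h4
    ring_nf at h4 ⊢
    linarith
  have h7 := sampleMean.mono hp h1
  rw [sampleMean.add, sampleMean.add, sampleMean.add, const_mul, const_mul, const_mul,
    sampleMean_empDist hp hn, sampleMean_empDist_sq hp hn, sampleMean_empDist_cube hp hn,
    const hp] at h7
  have h8 : (1 - p i) / (2 * n) - (1 - p i) * (1 - 2 * p i) / (6 * n * (n * p i)) ≤
      symbolBias n p i := by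
    rw [symbolBias, Real.negMulLog]
    have h9 : (1 - p i) / (2 * n) - (1 - p i) * (1 - 2 * p i) / (6 * n * (n * p i)) =
        -(p i / 3 + 1 / 2 * p i + -1 / p i * (p i ^ 2 + p i * (1 - p i) / n) +
          1 / (6 * p i ^ 2) * (p i / n ^ 2 + 3 * (n - 1) * p i ^ 2 / n ^ 2 +
            (n - 1) * (n - 2) * p i ^ 3 / n ^ 2)) := by
      field_simp
      ring
    linarith
  refine le_trans ?_ h8
  have h9 : (1 - p i) * (1 - 2 * p i) / (6 * n * (n * p i)) ≤ (1 - p i) / (3 * n) := by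
    rw [div_le_div_iff₀ (by positivity) (by positivity)]
    have : (1 - 2 * p i) ≤ 2 * (n * p i) := by nlinarith
    have h10 : 0 ≤ (1 - p i) * (3 * n) := by
      have : 0 ≤ 1 - p i := by linarith
      positivity
    nlinarith [mul_le_mul_of_nonneg_left this h10]
  have h11 : (1 - p i) / (2 * n) - (1 - p i) / (3 * n) = (1 - p i) / (6 * n) := by
    field_simp; ring
  have h12 : 1 / (12 * n) ≤ (1 - p i) / (6 * n) := by
    rw [div_le_div_iff₀ (by positivity) (by positivity)]
    nlinarith
  linarith

end empirical

section variance

variable {S n : ℕ} {p : Fin S → ℝ}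

open sampleMean

lemma sq_negMulLog_sub_le {a b : ℝ} (hb : 0 ≤ b) (hab : b < a) (ha : a ≤ 1) :
    (Real.negMulLog a - Real.negMulLog b) ^ 2 ≤ (a - b) ^ 2 * (1 - Real.log a) ^ 2 := by
  have ha0 : 0 < a := hb.trans_lt hab
  have hl : Real.log a ≤ 0 := Real.log_nonpos ha0.le ha
  have h1 := negMulLog_le_tangent hb ha0
  have h2 : b * Real.log b ≤ b * Real.log a := by
    rcases hb.eq_or_lt with rfl | hb
    · simp
    · exact mul_le_mul_of_nonneg_left (Real.log_le_log hb hab.le) hb.le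
  rw [← mul_pow]
  refine sq_le_sq' ?_ ?_
  · have : 0 ≤ (a - b) * (-Real.log a) := mul_nonneg (by linarith) (by linarith)
    simp only [Real.negMulLog] at *
    nlinarith
  · simp only [Real.negMulLog] at *
    nlinarith

/-- The second moment of `1 - log q` under `q`. -/
noncomputable def logMoment (q : Fin S → ℝ) : ℝ := ∑ i, q i * (1 - Real.log (q i)) ^ 2

/-- The plug-in entropy after removing the `j`-th sample, without renormalization. -/
noncomputable def leaveOneOutEntropy (j : Fin n) (x : Fin n → Fin S) : ℝ :=
  ∑ i, Real.negMulLog ((symbolCount x i - if x j = i then 1 else 0) / n)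

lemma leaveOneOutEntropy_update (j : Fin n) (x : Fin n → Fin S) (a : Fin S) :
    leaveOneOutEntropy j (Function.update x j a) = leaveOneOutEntropy j x := by
  have h : ∀ (y : Fin n → Fin S) i, (symbolCount y i - if y j = i then 1 else 0) =
      ∑ l ∈ Finset.univ.erase j, if y l = i then (1 : ℝ) else 0 := by
    intro y i
    rw [symbolCount, ← Finset.add_sum_erase _ _ (Finset.mem_univ j), add_sub_cancel_left]
  unfold leaveOneOutEntropy
  simp_rw [h]
  refine Finset.sum_congr rfl fun i _ => ?_
  congr 2
  refine Finset.sum_congr rfl fun l hl => ?_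
  rw [Function.update_of_ne (Finset.ne_of_mem_erase hl)]

lemma sum_sq_sub_leaveOneOut_le (hn : 0 < n) (x : Fin n → Fin S) :
    ∑ j, (entropy (empDist x) - leaveOneOutEntropy j x) ^ 2 ≤ logMoment (empDist x) / n := by
  have hn' : (0 : ℝ) < n := by positivity
  have h1 : ∀ j, (entropy (empDist x) - leaveOneOutEntropy j x) =
      Real.negMulLog (symbolCount x (x j) / n) -
        Real.negMulLog ((symbolCount x (x j) - 1) / n) := by
    intro j
    rw [entropy_eq, leaveOneOutEntropy, ← Finset.sum_sub_distrib,
      Finset.sum_eq_single (x j)]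
    · simp [empDist_eq]
    · intro i _ hi
      simp [empDist_eq, hi.symm]
    · simp
  simp_rw [h1]
  rw [sum_apply_eq_sum_symbolCount x fun i => (Real.negMulLog (symbolCount x i / n) -
        Real.negMulLog ((symbolCount x i - 1) / n)) ^ 2, logMoment, Finset.sum_div]
  refine Finset.sum_le_sum fun i _ => ?_
  have hle := (isDist_empDist hn x).le_one i
  rw [empDist_eq] at hle ⊢
  rcases symbolCount_eq_zero_or_one_le x i with h | h
  · simp [h]
  · have h2 := sq_negMulLog_sub_le (a := symbolCount x i / n) (b := (symbolCount x i - 1) / n)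
      (div_nonneg (by linarith) hn'.le) (by gcongr; linarith) hle
    calc _ ≤ _ := mul_le_mul_of_nonneg_left h2 (by linarith)
      _ = _ := by field_simp; ring

lemma variance_entropy_le (hp : IsDist p) (hn : 0 < n) :
    sampleMean p (fun x : Fin n → Fin S =>
      (entropy (empDist x) - sampleMean p (fun x : Fin n → Fin S => entropy (empDist x))) ^ 2) ≤
      sampleMean p (fun x : Fin n → Fin S => logMoment (empDist x)) / n := by
  refine (efron_stein hp _ leaveOneOutEntropy leaveOneOutEntropy_update).trans ?_
  rw [← sampleMean.sum, div_eq_inv_mul, ← const_mul]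
  refine sampleMean.mono hp fun x => ?_
  rw [← div_eq_inv_mul]
  exact sum_sq_sub_leaveOneOut_le hn x

lemma sampleMean_entropy_le (hp : IsDist p) (hn : 0 < n) :
    sampleMean p (fun x : Fin n → Fin S => entropy (empDist x)) ≤ entropy p := by
  have h := entropy_sub_sampleMean n p
  have := Finset.sum_nonneg fun i (_ : i ∈ Finset.univ) => symbolBias_nonneg hp hn i
  linarith

lemma mul_one_sub_log_sq_le_of_le {q B : ℝ} (hq : 0 ≤ q) (hq1 : q ≤ 1)
    (hB : q = 0 ∨ -Real.log q ≤ B) :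
    q * (1 - Real.log q) ^ 2 ≤ (1 + B) * (q + Real.negMulLog q) := by
  rcases hB with rfl | hB
  · simp
  · have hl : Real.log q ≤ 0 := Real.log_nonpos hq hq1
    have : q * (1 - Real.log q) ^ 2 = (1 - Real.log q) * (q + Real.negMulLog q) := by
      rw [Real.negMulLog]; ring
    rw [this]
    have := Real.negMulLog_nonneg hq hq1
    gcongr
    linarith

lemma sum_add_negMulLog {q : Fin S → ℝ} (hq : IsDist q) :
    ∑ i, (q i + Real.negMulLog (q i)) = 1 + entropy q := by
  rw [Finset.sum_add_distrib, hq.2, entropy_eq]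

lemma logMoment_empDist_le (hn : 0 < n) (x : Fin n → Fin S) :
    logMoment (empDist x) ≤ (1 + Real.log n) * (1 + entropy (empDist x)) := by
  have hd := isDist_empDist hn x
  rw [← sum_add_negMulLog hd, Finset.mul_sum, logMoment]
  refine Finset.sum_le_sum fun i _ => mul_one_sub_log_sq_le_of_le (hd.1 i) (hd.le_one i) ?_
  refine (empDist_eq_zero_or_inv_le hn x i).imp id fun h => ?_
  have := Real.log_le_log (by positivity) h
  rw [Real.log_inv] at this
  linarith

lemma mul_one_sub_log_sq_le_sqrt {q : ℝ} (hq : 0 ≤ q) (hq1 : q ≤ 1) :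
    q * (1 - Real.log q) ^ 2 ≤ 16 * √q := by
  rcases hq.eq_or_lt with rfl | hq
  · simp
  have hl : Real.log q ≤ 0 := Real.log_nonpos hq.le hq1
  set u := √(√q) with hu
  have hs : 0 < √q := Real.sqrt_pos.2 hq
  have hu0 : 0 < u := Real.sqrt_pos.2 hs
  have hu2 : u ^ 2 = √q := Real.sq_sqrt hs.le
  have hu4 : u ^ 4 = q := by rw [show u ^ 4 = (u ^ 2) ^ 2 by ring, hu2, Real.sq_sqrt hq.le]
  have hu1 : u ≤ 1 := by
    rw [hu]; exact Real.sqrt_le_one.2 (Real.sqrt_le_one.2 hq1)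
  have h1 : -Real.log q ≤ 4 * (1 / u - 1) := by
    have h := Real.log_le_sub_one_of_pos (one_div_pos.2 hu0)
    rw [Real.log_div one_ne_zero hu0.ne', Real.log_one] at h
    rw [← hu4, Real.log_pow]
    push_cast
    linarith
  have h2 : (1 - Real.log q) ^ 2 ≤ (4 / u) ^ 2 := by
    refine pow_le_pow_left₀ (by linarith) ?_ 2
    have : 4 * (1 / u - 1) = 4 / u - 4 := by ring
    linarith
  calc q * (1 - Real.log q) ^ 2 ≤ q * (4 / u) ^ 2 := mul_le_mul_of_nonneg_left h2 hq.le
    _ = 16 * √q := by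
      rw [← hu2, ← hu4]
      field_simp
      norm_num

lemma logMoment_le {q : Fin S → ℝ} (hq : IsDist q) (hS : 0 < S) :
    logMoment q ≤ (1 + 2 * Real.log S) * (1 + entropy q) + 16 := by
  have hS' : (0 : ℝ) < S := by positivity
  have hS1 : (1 : ℝ) ≤ S := by exact_mod_cast hS
  have hL : 0 ≤ Real.log S := Real.log_nonneg hS1
  have h1 : ∀ i, q i * (1 - Real.log (q i)) ^ 2 ≤
      (1 + 2 * Real.log S) * (q i + Real.negMulLog (q i)) + 16 / S := by
    intro i
    have hq0 := hq.1 i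
    have hq1 := hq.le_one i
    have hnm := Real.negMulLog_nonneg hq0 hq1
    rcases le_total (q i) (1 / (S : ℝ) ^ 2) with h | h
    · have h2 := mul_one_sub_log_sq_le_sqrt hq0 hq1
      have h3 : √(q i) ≤ 1 / S := by
        rw [Real.sqrt_le_left (by positivity), div_pow, one_pow]; exact h
      have : 0 ≤ (1 + 2 * Real.log S) * (q i + Real.negMulLog (q i)) := by positivity
      have : 16 * √(q i) ≤ 16 / S := by
        rw [div_eq_mul_one_div]; gcongr
      linarith
    · have h2 := mul_one_sub_log_sq_le_of_le (B := 2 * Real.log S) hq0 hq1 (Or.inr ?_)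
      · have : (0 : ℝ) ≤ 16 / S := by positivity
        linarith
      · have := Real.log_le_log (by positivity) h
        rw [Real.log_div one_ne_zero (by positivity), Real.log_one, Real.log_pow] at this
        push_cast at this
        linarith
  calc logMoment q ≤ _ := Finset.sum_le_sum fun i _ => h1 i
    _ = _ := by
      rw [Finset.sum_add_distrib, ← Finset.mul_sum, sum_add_negMulLog hq]
      simp
      field_simp

lemma mleRisk_eq (hp : IsDist p) :
    mleRisk S n p = sampleMean p (fun x : Fin n → Fin S =>
      (entropy (empDist x) - sampleMean p (fun x : Fin n → Fin S => entropy (empDist x))) ^ 2) +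
      (∑ i, symbolBias n p i) ^ 2 := by
  rw [← entropy_sub_sampleMean, ← neg_sq (entropy p - _), neg_sub, ← sq_sub_const hp]
  rfl

lemma sq_bias_le_mleRisk (hp : IsDist p) :
    (∑ i, symbolBias n p i) ^ 2 ≤ mleRisk S n p := by
  rw [mleRisk_eq hp, le_add_iff_nonneg_left]
  simpa [const hp] using sampleMean.mono (p := p) hp (F := fun _ => 0) fun x : Fin n → Fin S =>
    sq_nonneg (entropy (empDist x) -
      sampleMean p (fun x : Fin n → Fin S => entropy (empDist x)))

lemma mleRisk_le_log_sampleSize (hp : IsDist p) (hn : 0 < n) :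
    mleRisk S n p ≤ (1 + Real.log n) * (1 + entropy p) / n + (∑ i, symbolBias n p i) ^ 2 := by
  have hl : 0 ≤ Real.log n := Real.log_nonneg (by exact_mod_cast hn)
  rw [mleRisk_eq hp]
  refine add_le_add_left ((variance_entropy_le hp hn).trans ?_) _
  gcongr
  refine (sampleMean.mono hp (logMoment_empDist_le hn)).trans ?_
  rw [const_mul, add, const hp]
  gcongr
  exact sampleMean_entropy_le hp hn

lemma mleRisk_le_log_alphabetSize (hp : IsDist p) (hn : 0 < n) (hS : 0 < S) :
    mleRisk S n p ≤ ((1 + 2 * Real.log S) * (1 + entropy p) + 16) / n +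
      (∑ i, symbolBias n p i) ^ 2 := by
  have hl : 0 ≤ Real.log S := Real.log_nonneg (by exact_mod_cast hS)
  rw [mleRisk_eq hp]
  refine add_le_add_left ((variance_entropy_le hp hn).trans ?_) _
  gcongr
  refine (sampleMean.mono hp fun x => logMoment_le (isDist_empDist hn x) hS).trans ?_
  rw [add, const_mul, add, const hp, const hp]
  gcongr
  exact sampleMean_entropy_le hp hn

lemma sum_symbolBias_le_div (hp : IsDist p) (hn : 0 < n) :
    ∑ i, symbolBias n p i ≤ S / n := by
  have hn' : (0 : ℝ) < n := by positivity
  calc ∑ i, symbolBias n p i ≤ ∑ _i : Fin S, 1 / (n : ℝ) := by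
        refine Finset.sum_le_sum fun i _ => (symbolBias_le hp hn i).trans ?_
        rcases (hp.1 i).eq_or_lt with h | h
        · simp [← h]
        · have := Real.log_le_sub_one_of_pos (show 0 < 1 + 1 / (n * p i) by positivity)
          calc p i * Real.log (1 + 1 / (n * p i)) ≤ p i * (1 / (n * p i)) := by
                gcongr; linarith
            _ = 1 / n := by field_simp
    _ = S / n := by simp; ring

lemma sum_symbolBias_le_entropy (hp : IsDist p) (hn : 0 < n) :
    ∑ i, symbolBias n p i ≤ entropy p := by
  rw [← entropy_sub_sampleMean, sub_le_self_iff]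
  simpa [const hp] using sampleMean.mono (p := p) hp (F := fun _ => 0) fun x : Fin n → Fin S =>
    (isDist_empDist hn x).entropy_nonneg

lemma sum_symbolBias_nonneg (hp : IsDist p) (hn : 0 < n) :
    0 ≤ ∑ i, symbolBias n p i :=
  Finset.sum_nonneg fun i _ => symbolBias_nonneg hp hn i

/-- Symbols of probability at most `exp (-ℓ)` carry total mass at most `entropy p / ℓ`; the
remaining ones contribute to the bias as if there were only `exp ℓ` of them. -/
lemma sum_symbolBias_le_of_pos (hp : IsDist p) (hn : 0 < n) {ℓ a : ℝ} (hℓ : 0 < ℓ) (ha : 0 < a) :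
    ∑ i, symbolBias n p i ≤
      Real.exp ℓ / n + entropy p / ℓ * Real.log (1 + a) + S / (n * a) := by
  have hn' : (0 : ℝ) < n := by positivity
  have hla : 0 < Real.log (1 + a) := Real.log_pos (by linarith)
  have h1 : ∀ i, symbolBias n p i ≤
      Real.exp ℓ / n * p i + (Real.log (1 + a) / ℓ) * Real.negMulLog (p i) + 1 / (n * a) := by
    intro i
    have hnm := Real.negMulLog_nonneg (hp.1 i) (hp.le_one i)
    refine (symbolBias_le hp hn i).trans ?_
    rcases (hp.1 i).eq_or_lt with h | h
    · rw [← h]; simp; positivity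
    rcases le_total (Real.exp (-ℓ)) (p i) with h2 | h2
    · have h3 := Real.log_le_sub_one_of_pos (show 0 < 1 + 1 / (n * p i) by positivity)
      have h4 : p i * Real.log (1 + 1 / (n * p i)) ≤ p i * (1 / (n * p i)) := by
        gcongr; linarith
      have h5 : p i * (1 / (n * p i)) = 1 / n := by field_simp
      have h6 : 1 / n ≤ Real.exp ℓ / n * p i := by
        rw [div_mul_eq_mul_div]
        gcongr
        calc 1 = Real.exp ℓ * Real.exp (-ℓ) := by rw [← Real.exp_add]; simp
          _ ≤ _ := by gcongr
      have : 0 ≤ (Real.log (1 + a) / ℓ) * Real.negMulLog (p i) := by positivity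
      have : 0 ≤ 1 / (n * a) := by positivity
      linarith
    · have h3 := Real.log_le_sub_one_of_pos
        (show 0 < (1 + 1 / (n * p i)) / (1 + a) by positivity)
      rw [Real.log_div (by positivity) (by positivity)] at h3
      have h4 : (1 + 1 / (n * p i)) / (1 + a) - 1 ≤ 1 / (n * p i) / a := by
        rw [sub_le_iff_le_add, div_le_iff₀ (by positivity)]
        have : (1 / (n * p i) / a + 1) * (1 + a) =
          1 + 1 / (n * p i) + (a + 1 / (n * p i) / a) := by field_simp; ring
        rw [this]
        have : 0 < a + 1 / (n * p i) / a := by positivity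
        linarith
      have h5 : p i * Real.log (1 + 1 / (n * p i)) ≤
          p i * (Real.log (1 + a) + 1 / (n * p i) / a) := by gcongr; linarith
      have h6 : p i * (1 / (n * p i) / a) = 1 / (n * a) := by field_simp
      have h7 : p i ≤ Real.negMulLog (p i) / ℓ := by
        have := Real.log_le_log h h2
        rw [Real.log_exp] at this
        rw [le_div_iff₀ hℓ, Real.negMulLog]
        nlinarith
      have h8 : p i * Real.log (1 + a) ≤ Real.negMulLog (p i) / ℓ * Real.log (1 + a) := by gcongr
      have : 0 ≤ Real.exp ℓ / n * p i := by positivity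
      have : Real.negMulLog (p i) / ℓ * Real.log (1 + a) =
        (Real.log (1 + a) / ℓ) * Real.negMulLog (p i) := by ring
      linarith
  calc _ ≤ _ := Finset.sum_le_sum fun i _ => h1 i
    _ = _ := by
      rw [Finset.sum_add_distrib, Finset.sum_add_distrib, ← Finset.mul_sum, ← Finset.mul_sum,
        hp.2, ← entropy_eq]
      simp
      ring

end variance

section upper

variable {S n : ℕ} {p : Fin S → ℝ} {H : ℝ}

lemma mleRisk_le_of_entropy_le (hp : IsDist p) (hpH : entropy p ≤ H) (hn : 0 < n) (hS : 0 < S) :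
    mleRisk S n p ≤ ((1 + 2 * Real.log S) * (1 + H) + 16) / n + ((S : ℝ) / n) ^ 2 := by
  have hl : 0 ≤ Real.log S := Real.log_nonneg (by exact_mod_cast hS)
  refine (mleRisk_le_log_alphabetSize hp hn hS).trans ?_
  have := sum_symbolBias_le_div hp hn
  have := sum_symbolBias_nonneg hp hn
  gcongr

lemma mleRisk_le_dense (hp : IsDist p) (hpH : entropy p ≤ H) (hn : 0 < n) (hS : 0 < S)
    (hH : 3 ≤ H) (hHS : H ≤ Real.log S) :
    mleRisk S n p ≤ 8 * (((S : ℝ) / n) ^ 2 + H * Real.log S / n) := by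
  have hn' : (0 : ℝ) < n := by positivity
  have h1 := mleRisk_le_of_entropy_le hp hpH hn hS
  have h2 : (1 + 2 * Real.log S) * (1 + H) + 16 ≤ 8 * (H * Real.log S) := by nlinarith
  have h3 : ((1 + 2 * Real.log S) * (1 + H) + 16) / n ≤ 8 * (H * Real.log S) / n := by gcongr
  have h4 : 0 ≤ ((S : ℝ) / n) ^ 2 := by positivity
  rw [mul_div_assoc] at h3
  linarith

lemma mleRisk_le_sparse (hp : IsDist p) (hpH : entropy p ≤ H) (hn : 0 < n) (hS : 0 < S)
    (hH : 3 ≤ H) (hHS : H ≤ Real.log S) (hSn : Real.exp 1 * n * H < S * Real.log S) :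
    mleRisk S n p ≤
      400 * ((H / Real.log S) * Real.log ((S : ℝ) * Real.log S / (n * H))) ^ 2 := by
  have hn' : (0 : ℝ) < n := by positivity
  have hn1 : (1 : ℝ) ≤ n := by exact_mod_cast hn
  have hS' : (0 : ℝ) < S := by positivity
  set L := Real.log S with hL
  have hL0 : 0 < L := by linarith
  have hH0 : 0 < H := by linarith
  set a := (S : ℝ) * L / (n * H) with ha
  have hae : Real.exp 1 < a := by
    rw [ha, lt_div_iff₀ (by positivity)]; linarith
  have ha2 : 2 < a := by have := Real.exp_one_gt_d9; linarith
  have hla : 1 < Real.log a := by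
    rw [Real.lt_log_iff_exp_lt (by linarith)]; exact hae
  have hb0 := sum_symbolBias_nonneg hp hn
  have hent := hp.entropy_nonneg
  have hlogn : 0 ≤ Real.log n := Real.log_nonneg hn1
  have hrisk : mleRisk S n p ≤ (1 + Real.log n) / n * (1 + H) +
      (∑ i, symbolBias n p i) ^ 2 := by
    refine (mleRisk_le_log_sampleSize hp hn).trans ?_
    rw [div_mul_eq_mul_div]
    gcongr
  rcases le_total (Real.log n) (L / 2) with hcase | hcase
  · have h1 : L / 2 ≤ Real.log a := by
      have h2 : (S : ℝ) / n ≤ a := by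
        rw [ha, div_le_div_iff₀ hn' (by positivity)]
        have : (S : ℝ) * (n * H) ≤ S * (n * L) := by gcongr
        linarith
      have h3 := Real.log_le_log (by positivity) h2
      rw [Real.log_div hS'.ne' hn'.ne'] at h3
      linarith
    have h2 : H / 2 ≤ H / L * Real.log a := by
      calc H / 2 = H / L * (L / 2) := by field_simp
        _ ≤ _ := by gcongr
    have h3 : (H / 2) ^ 2 ≤ (H / L * Real.log a) ^ 2 := by gcongr
    have h4 : (1 + Real.log n) / n ≤ 1 := by
      rw [div_le_one hn']
      linarith [Real.log_le_sub_one_of_pos hn']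
    have h5 : (∑ i, symbolBias n p i) ^ 2 ≤ H ^ 2 := by
      have := (sum_symbolBias_le_entropy hp hn).trans hpH
      gcongr
    have h6 : (1 + Real.log n) / n * (1 + H) ≤ 1 * (1 + H) := by gcongr
    nlinarith
  · have hexp : Real.exp (L / 4) / n ≤ 4 / L := by
      have h1 : Real.exp (L / 2) ≤ n := by
        rw [← Real.le_log_iff_exp_le hn']; exact hcase
      calc Real.exp (L / 4) / n ≤ Real.exp (L / 4) / Real.exp (L / 2) := by gcongr
        _ = 1 / Real.exp (L / 4) := by
          rw [← Real.exp_sub, one_div, ← Real.exp_neg]; congr 1; ring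
        _ ≤ 1 / (L / 4) := by
          gcongr
          linarith [Real.add_one_le_exp (L / 4)]
        _ = 4 / L := by field_simp
    have hlog : Real.log (1 + a) ≤ 2 * Real.log a := by
      have : Real.log (1 + a) ≤ Real.log (a ^ 2) := Real.log_le_log (by linarith) (by nlinarith)
      rwa [Real.log_pow] at this
    have hbias : ∑ i, symbolBias n p i ≤ 12 * (H / L * Real.log a) := by
      have h1 := sum_symbolBias_le_of_pos hp hn (ℓ := L / 4) (a := a) (by linarith) (by linarith)
      have h2 : (S : ℝ) / (n * a) = H / L := by rw [ha]; field_simp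
      have h3 : entropy p / (L / 4) * Real.log (1 + a) ≤ H / (L / 4) * (2 * Real.log a) := by
        have : 0 ≤ Real.log (1 + a) := Real.log_nonneg (by linarith)
        gcongr
      have h4 : H / (L / 4) * (2 * Real.log a) = 8 * (H / L * Real.log a) := by
        field_simp; ring
      have h5 : H / L ≤ H / L * Real.log a := le_mul_of_one_le_right (by positivity) hla.le
      have h6 : 4 / L ≤ 2 * (H / L) := by
        rw [← mul_div_assoc]; gcongr; linarith
      linarith
    have hvar : (1 + Real.log n) / n ≤ 108 / L ^ 2 := by
      rw [div_le_div_iff₀ hn' (by positivity)]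
      set u := Real.log n with hu
      have h1 : 1 + u ≤ 3 * Real.exp (u / 3) := by linarith [Real.add_one_le_exp (u / 3)]
      have h2 : (1 + u) ^ 3 ≤ (3 * Real.exp (u / 3)) ^ 3 := by gcongr
      have h3 : (3 * Real.exp (u / 3)) ^ 3 = 27 * n := by
        rw [mul_pow, ← Real.exp_nat_mul]
        push_cast
        rw [show 3 * (u / 3) = u by ring, hu, Real.exp_log hn']
        norm_num
      have h4 : L ^ 2 ≤ (2 * (1 + u)) ^ 2 := by gcongr; linarith
      calc (1 + u) * L ^ 2 ≤ (1 + u) * (2 * (1 + u)) ^ 2 := by gcongr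
        _ = 4 * (1 + u) ^ 3 := by ring
        _ ≤ 108 * n := by linarith
    have h1 : (1 + Real.log n) / n * (1 + H) ≤ 108 * (H / L) ^ 2 := by
      calc _ ≤ 108 / L ^ 2 * H ^ 2 := by gcongr; nlinarith
        _ = _ := by ring
    have h2 : (H / L) ^ 2 ≤ (H / L * Real.log a) ^ 2 := by
      gcongr
      exact le_mul_of_one_le_right (by positivity) hla.le
    have h3 : (∑ i, symbolBias n p i) ^ 2 ≤ (12 * (H / L * Real.log a)) ^ 2 := by gcongr
    rw [mul_pow] at h3
    nlinarith [sq_nonneg (H / L * Real.log a)]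

lemma mleRisk_le_mleSupRisk (hn : 0 < n) (hS : 0 < S) (hp : IsDist p) (hpH : entropy p ≤ H) :
    mleRisk S n p ≤ mleSupRisk S n H := by
  refine le_csSup ⟨((1 + 2 * Real.log S) * (1 + H) + 16) / n + ((S : ℝ) / n) ^ 2, ?_⟩
    ⟨p, hp, hpH, rfl⟩
  rintro _ ⟨q, hq, hqH, rfl⟩
  exact mleRisk_le_of_entropy_le hq hqH hn hS

end upper

section affinity

variable {S n : ℕ} {p q : Fin S → ℝ}

lemma sum_sqrt_multProb (hp : IsDist p) (hq : IsDist q) :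
    ∑ x : Fin n → Fin S, √(multProb p x) * √(multProb q x) = (∑ i, √(p i * q i)) ^ n := by
  rw [Fintype.sum_pow]
  refine Finset.sum_congr rfl fun x _ => ?_
  simp only [multProb]
  rw [Real.sqrt_prod _ fun j _ => hp.1 (x j), Real.sqrt_prod _ fun j _ => hq.1 (x j),
    ← Finset.prod_mul_distrib]
  exact Finset.prod_congr rfl fun j _ => (Real.sqrt_mul (hp.1 _) _).symm

lemma sum_sqrt_multProb_mul_abs_le (hp : IsDist p) (hq : IsDist q) :
    ∑ x : Fin n → Fin S, √(multProb p x) * √(multProb q x) * |entropy (empDist x) - entropy p| ≤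
      √(mleRisk S n p) := by
  have hpos : ∀ {r : Fin S → ℝ}, IsDist r → ∀ x : Fin n → Fin S, 0 ≤ multProb r x :=
    fun hr x => Finset.prod_nonneg fun j _ => hr.1 (x j)
  have h := Real.sum_mul_le_sqrt_mul_sqrt (Finset.univ : Finset (Fin n → Fin S))
    (fun x => √(multProb q x))
    (fun x => √(multProb p x) * |entropy (empDist x) - entropy p|)
  have h1 : ∑ x : Fin n → Fin S, √(multProb q x) ^ 2 = 1 := by
    simp_rw [Real.sq_sqrt (hpos hq _)]
    simpa [sampleMean] using sampleMean.const (n := n) hq 1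
  have h2 : ∑ x : Fin n → Fin S, (√(multProb p x) * |entropy (empDist x) - entropy p|) ^ 2 =
      mleRisk S n p := by
    simp_rw [mul_pow, Real.sq_sqrt (hpos hp _), sq_abs]
    rfl
  rw [h1, h2, Real.sqrt_one, one_mul] at h
  refine le_trans (le_of_eq ?_) h
  exact Finset.sum_congr rfl fun x _ => by ring

lemma abs_entropy_sub_mul_affinity_le (hp : IsDist p) (hq : IsDist q) :
    |entropy q - entropy p| * (∑ i, √(p i * q i)) ^ n ≤
      √(mleRisk S n p) + √(mleRisk S n q) := by
  rw [← sum_sqrt_multProb hp hq, Finset.mul_sum]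
  refine le_trans ?_ (add_le_add (sum_sqrt_multProb_mul_abs_le hp hq)
    (sum_sqrt_multProb_mul_abs_le hq hp))
  rw [← Finset.sum_add_distrib]
  refine Finset.sum_le_sum fun x _ => ?_
  rw [mul_comm √(multProb q x), ← mul_add, mul_comm]
  gcongr
  rw [abs_sub_comm (entropy (empDist x)) (entropy q), add_comm]
  exact abs_sub_le _ _ _

end affinity

section twoLevel

variable {m n : ℕ} {δ H : ℝ}

/-- The distribution with mass `1 - δ` on one symbol and the rest spread evenly over `m` others. -/
noncomputable def twoLevel (m : ℕ) (δ : ℝ) : Fin (m + 1) → ℝ :=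
  Fin.cons (1 - δ) fun _ => δ / m

lemma isDist_twoLevel (hm : 0 < m) (h0 : 0 ≤ δ) (h1 : δ ≤ 1) : IsDist (twoLevel m δ) := by
  constructor
  · intro i
    refine Fin.cases ?_ (fun j => ?_) i
    · simpa [twoLevel] using h1
    · simp only [twoLevel, Fin.cons_succ]; positivity
  · have : (m : ℝ) ≠ 0 := by positivity
    rw [Fin.sum_univ_succ]
    simp [twoLevel]
    field_simp
    ring

lemma entropy_twoLevel (hm : 0 < m) (h0 : 0 < δ) :
    entropy (twoLevel m δ) = Real.binEntropy δ + δ * Real.log m := by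
  have hm' : (0 : ℝ) < m := by positivity
  rw [entropy_eq, Fin.sum_univ_succ, Real.binEntropy_eq_negMulLog_add_negMulLog_one_sub]
  simp [twoLevel, Real.negMulLog]
  rw [Real.log_div h0.ne' hm'.ne']
  field_simp
  ring

lemma entropy_twoLevel_le (hm : 0 < m) (h0 : 0 < δ) :
    entropy (twoLevel m δ) ≤ 1 + δ * Real.log m := by
  rw [entropy_twoLevel hm h0]
  have h1 := Real.binEntropy_le_log_two (p := δ)
  have h2 := Real.log_two_lt_d9
  linarith

lemma twoLevel_mem (hm : 0 < m) (h0 : 0 < δ) (hH : 3 ≤ H) (hHL : H ≤ Real.log (m + 1 : ℕ))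
    (hδ : δ ≤ H / (2 * Real.log (m + 1 : ℕ))) :
    δ ≤ 1 / 2 ∧ IsDist (twoLevel m δ) ∧ entropy (twoLevel m δ) ≤ H := by
  set L := Real.log (m + 1 : ℕ) with hL
  have hL0 : 0 < L := by linarith
  have h1 : δ ≤ 1 / 2 := by
    refine hδ.trans ?_
    rw [div_le_div_iff₀ (by positivity) (by norm_num)]
    linarith
  refine ⟨h1, isDist_twoLevel hm h0.le (by linarith), (entropy_twoLevel_le hm h0).trans ?_⟩
  have h2 : Real.log m ≤ L := Real.log_le_log (by positivity) (by push_cast; linarith)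
  have h3 : δ * Real.log m ≤ H / (2 * L) * L := by
    have : 0 ≤ Real.log m := Real.log_nonneg (by exact_mod_cast hm)
    gcongr
  have h4 : H / (2 * L) * L = H / 2 := by field_simp
  linarith

lemma mul_symbolBias_le_sum (hn : 0 < n) (hd : IsDist (twoLevel m δ)) {β : ℝ}
    (hβ : ∀ j : Fin m, β ≤ symbolBias n (twoLevel m δ) j.succ) :
    m * β ≤ ∑ i, symbolBias n (twoLevel m δ) i := by
  rw [Fin.sum_univ_succ]
  have h1 := symbolBias_nonneg hd hn 0
  have h2 := Finset.sum_le_sum fun (j : Fin m) (_ : j ∈ Finset.univ) => hβ j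
  simp only [Finset.sum_const, Finset.card_univ, Fintype.card_fin, nsmul_eq_mul] at h2
  linarith

lemma log_le_sum_symbolBias_twoLevel (hm : 0 < m) (hn : 0 < n) (h0 : 0 < δ)
    (hd : IsDist (twoLevel m δ)) :
    δ * Real.log (m / (n * δ)) ≤ ∑ i, symbolBias n (twoLevel m δ) i := by
  have hm' : (0 : ℝ) < m := by positivity
  have hn' : (0 : ℝ) < n := by positivity
  refine le_trans (le_of_eq ?_) (mul_symbolBias_le_sum hn hd
    (β := Real.negMulLog (δ / m) - δ / m * Real.log n) fun j => symbolBias_ge_log hd hn j.succ)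
  rw [Real.negMulLog]
  rw [Real.log_div hm'.ne' (by positivity), Real.log_mul hn'.ne' h0.ne',
    Real.log_div h0.ne' hm'.ne']
  field_simp
  ring

lemma mleSupRisk_ge_sparse (hm : 0 < m) (hn : 0 < n) (hH : 3 ≤ H)
    (hHL : H ≤ Real.log (m + 1 : ℕ))
    (hSn : Real.exp 1 * n * H < (m + 1 : ℕ) * Real.log (m + 1 : ℕ)) :
    1 / 4 * (H / Real.log (m + 1 : ℕ) *
      Real.log ((m + 1 : ℕ) * Real.log (m + 1 : ℕ) / (n * H))) ^ 2 ≤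
      mleSupRisk (m + 1) n H := by
  set L := Real.log (m + 1 : ℕ) with hL
  have hL0 : 0 < L := by linarith
  have hH0 : 0 < H := by linarith
  have hn' : (0 : ℝ) < n := by positivity
  have hm1 : (1 : ℝ) ≤ m := by exact_mod_cast hm
  have hδ0 : 0 < H / (2 * L) := by positivity
  obtain ⟨-, hd, he⟩ := twoLevel_mem hm hδ0 hH hHL le_rfl
  refine le_trans ?_ ((sq_bias_le_mleRisk hd).trans
    (mleRisk_le_mleSupRisk hn (Nat.succ_pos m) hd he))
  have h1 := log_le_sum_symbolBias_twoLevel hm hn hδ0 hd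
  have ha : 1 ≤ ((m + 1 : ℕ) : ℝ) * L / (n * H) := by
    rw [one_le_div (by positivity)]
    have := Real.exp_one_gt_d9
    have : 1 * (n * H) ≤ Real.exp 1 * (n * H) := by gcongr; linarith
    linarith
  have h2 : Real.log (((m + 1 : ℕ) : ℝ) * L / (n * H)) ≤ Real.log (m / (n * (H / (2 * L)))) := by
    refine Real.log_le_log (by linarith) ?_
    have : (m : ℝ) / (n * (H / (2 * L))) = (2 * m) * L / (n * H) := by field_simp
    rw [this]
    gcongr
    push_cast
    linarith
  have h3 : H / (2 * L) * Real.log (((m + 1 : ℕ) : ℝ) * L / (n * H)) ≤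
      ∑ i, symbolBias n (twoLevel m (H / (2 * L))) i := le_trans (by gcongr) h1
  have h4 : 0 ≤ Real.log (((m + 1 : ℕ) : ℝ) * L / (n * H)) := Real.log_nonneg ha
  calc _ = (H / (2 * L) * Real.log (((m + 1 : ℕ) : ℝ) * L / (n * H))) ^ 2 := by
        ring
    _ ≤ _ := by gcongr

lemma mleSupRisk_ge_bias_dense (hm : 0 < m) (hn : 0 < n) (hH : 3 ≤ H)
    (hHL : H ≤ Real.log (m + 1 : ℕ))
    (hSn : (m + 1 : ℕ) * Real.log (m + 1 : ℕ) ≤ Real.exp 1 * n * H) :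
    1 / 576 * (((m + 1 : ℕ) : ℝ) / n) ^ 2 ≤ mleSupRisk (m + 1) n H := by
  set L := Real.log (m + 1 : ℕ) with hL
  have hL0 : 0 < L := by linarith
  have hH0 : 0 < H := by linarith
  have hn' : (0 : ℝ) < n := by positivity
  have hm' : (0 : ℝ) < m := by positivity
  have hm1 : (1 : ℝ) ≤ m := by exact_mod_cast hm
  set δ := H / (2 * L) with hδ
  have hδ0 : 0 < δ := by positivity
  obtain ⟨hδ1, hd, he⟩ := twoLevel_mem hm hδ0 hH hHL le_rfl
  refine le_trans ?_ ((sq_bias_le_mleRisk hd).trans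
    (mleRisk_le_mleSupRisk hn (Nat.succ_pos m) hd he))
  have hnδ : ((m + 1 : ℕ) : ℝ) ≤ 6 * (n * δ) := by
    have h1 : n * δ = n * H / (2 * L) := by rw [hδ]; ring
    rw [h1, ← mul_div_assoc, le_div_iff₀ (by positivity)]
    have h2 := Real.exp_one_lt_d9
    have h3 : Real.exp 1 * (n * H) ≤ 3 * (n * H) := by gcongr; linarith
    linarith
  suffices h : 1 / 24 * (((m + 1 : ℕ) : ℝ) / n) ≤ ∑ i, symbolBias n (twoLevel m δ) i by
    calc _ = (1 / 24 * (((m + 1 : ℕ) : ℝ) / n)) ^ 2 := by ring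
      _ ≤ _ := by gcongr
  rcases le_total (1 / 2 : ℝ) (n * (δ / m)) with h | h
  · refine le_trans ?_ (mul_symbolBias_le_sum hn hd (β := 1 / (12 * n)) fun j => ?_)
    · rw [← sub_nonneg]
      have : m * (1 / (12 * n)) - 1 / 24 * (((m + 1 : ℕ) : ℝ) / n) = (m - 1) / (24 * n) := by
        push_cast; field_simp; ring
      rw [this]
      exact div_nonneg (by linarith) (by positivity)
    · refine symbolBias_ge_inv hd hn j.succ ?_ ?_
      · simp only [twoLevel, Fin.cons_succ]
        exact (div_le_self hδ0.le hm1).trans hδ1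
      · simpa only [twoLevel, Fin.cons_succ] using h
  · refine le_trans ?_ (log_le_sum_symbolBias_twoLevel hm hn hδ0 hd)
    have h1 : Real.log 2 ≤ Real.log (m / (n * δ)) := by
      refine Real.log_le_log (by norm_num) ?_
      rw [le_div_iff₀ (by positivity)]
      rw [← mul_div_assoc, div_le_iff₀ hm'] at h
      linarith
    have h2 := Real.log_two_gt_d9
    have h3 : 1 / 6 * (((m + 1 : ℕ) : ℝ) / n) ≤ δ := by
      rw [← mul_div_assoc, div_le_iff₀ hn']
      linarith
    have h4 : δ * (1 / 4) ≤ δ * Real.log (m / (n * δ)) := by gcongr; linarith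
    linarith

lemma sqrt_mul_ge_harmonic {a b : ℝ} (ha : 0 < a) (hb : 0 < b) :
    2 * (a * b) / (a + b) ≤ √(a * b) := by
  rw [div_le_iff₀ (by positivity)]
  have h1 := Real.sq_sqrt (mul_pos ha hb).le
  have h2 : 2 * √(a * b) ≤ a + b := by
    have h3 := Real.sqrt_nonneg (a * b)
    nlinarith [sq_nonneg (a - b)]
  nlinarith [Real.sqrt_nonneg (a * b)]

lemma affinity_twoLevel_ge (hm : 0 < m) {d : ℝ} (h0 : 0 < δ) (hd : 0 ≤ d) (h1 : δ + d ≤ 1 / 2) :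
    1 - d ^ 2 / (2 * δ) ≤ ∑ i, √(twoLevel m δ i * twoLevel m (δ + d) i) := by
  have hm' : (0 : ℝ) < m := by positivity
  have h2 : ∑ i, √(twoLevel m δ i * twoLevel m (δ + d) i) =
      √((1 - δ) * (1 - (δ + d))) + √(δ * (δ + d)) := by
    rw [Fin.sum_univ_succ]
    simp only [twoLevel, Fin.cons_zero, Fin.cons_succ, Finset.sum_const, Finset.card_univ,
      Fintype.card_fin, nsmul_eq_mul]
    rw [div_mul_div_comm, Real.sqrt_div (by positivity), Real.sqrt_mul_self hm'.le]
    field_simp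
  rw [h2]
  have h3 := sqrt_mul_ge_harmonic h0 (show 0 < δ + d by linarith)
  have h4 := sqrt_mul_ge_harmonic (show 0 < 1 - δ by linarith) (show 0 < 1 - (δ + d) by linarith)
  have h5 : δ + d / 2 - d ^ 2 / (4 * δ) ≤ 2 * (δ * (δ + d)) / (δ + (δ + d)) := by
    have : 2 * (δ * (δ + d)) / (δ + (δ + d)) = δ + d / 2 - d ^ 2 / (2 * (δ + (δ + d))) := by
      field_simp; ring
    rw [this]
    exact sub_le_sub_left
      (div_le_div_of_nonneg_left (sq_nonneg d) (by linarith) (by linarith)) _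
  have h6 : 1 - δ - d / 2 - d ^ 2 / (4 * δ) ≤
      2 * ((1 - δ) * (1 - (δ + d))) / (1 - δ + (1 - (δ + d))) := by
    have h7 : 0 < 1 - δ + (1 - (δ + d)) := by linarith
    have : 2 * ((1 - δ) * (1 - (δ + d))) / (1 - δ + (1 - (δ + d))) =
        1 - δ - d / 2 - d ^ 2 / (2 * (1 - δ + (1 - (δ + d)))) := by
      field_simp; ring
    rw [this]
    exact sub_le_sub_left
      (div_le_div_of_nonneg_left (sq_nonneg d) (by linarith) (by linarith)) _
  have h8 : d ^ 2 / (2 * δ) = d ^ 2 / (4 * δ) + d ^ 2 / (4 * δ) := by field_simp; ring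
  linarith

lemma mleSupRisk_ge_variance_dense (hm : 2 ≤ m) (hn : 0 < n) (hH : 3 ≤ H)
    (hHL : H ≤ Real.log (m + 1 : ℕ))
    (hSn : (m + 1 : ℕ) * Real.log (m + 1 : ℕ) ≤ Real.exp 1 * n * H) :
    1 / 1000 * (H * Real.log (m + 1 : ℕ) / n) ≤ mleSupRisk (m + 1) n H := by
  set L := Real.log (m + 1 : ℕ) with hL
  have hm0 : 0 < m := by omega
  have hL0 : 0 < L := by linarith
  have hH0 : 0 < H := by linarith
  have hn' : (0 : ℝ) < n := by positivity
  have hm' : (2 : ℝ) ≤ m := by exact_mod_cast hm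
  set R := mleSupRisk (m + 1) n H with hR
  set δ := H / (4 * L) with hδ
  have hδ0 : 0 < δ := by positivity
  have hnδ : 1 ≤ 2 * (n * δ) := by
    have h0 : (20 : ℝ) ≤ (m + 1 : ℕ) := by
      have h1 : Real.exp 3 ≤ (m + 1 : ℕ) := by
        rw [← Real.le_log_iff_exp_le (by positivity)]; linarith
      have h2 : Real.exp 3 = Real.exp 1 ^ 3 := by rw [← Real.exp_nat_mul]; norm_num
      have h3 : (2.715 : ℝ) ^ 3 ≤ Real.exp 1 ^ 3 := by
        have := Real.exp_one_gt_d9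
        gcongr
        linarith
      norm_num at h3
      linarith
    have h1 : n * δ = n * H / (4 * L) := by rw [hδ]; ring
    rw [h1, ← mul_div_assoc, le_div_iff₀ (by positivity)]
    have h2 := Real.exp_one_lt_d9
    have h3 : Real.exp 1 * (n * H) ≤ 3 * (n * H) := by gcongr; linarith
    have h4 : 20 * L ≤ (m + 1 : ℕ) * L := by gcongr
    linarith
  set d := √(δ / (2 * n)) with hd
  have hd2 : d ^ 2 = δ / (2 * n) := Real.sq_sqrt (by positivity)
  have hd0 : 0 < d := Real.sqrt_pos.2 (by positivity)
  have hdδ : d ≤ δ := by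
    rw [hd, Real.sqrt_le_left hδ0.le, div_le_iff₀ (by positivity)]
    nlinarith
  have h2δ : δ + δ = H / (2 * L) := by rw [hδ]; field_simp; ring
  obtain ⟨-, hp, hpH⟩ := twoLevel_mem hm0 hδ0 hH hHL (by linarith)
  obtain ⟨hδ1, hq, hqH⟩ := twoLevel_mem (δ := δ + d) hm0 (by positivity) hH hHL (by linarith)
  have h1 := abs_entropy_sub_mul_affinity_le (n := n) hp hq
  have h2 : 1 / 2 ≤ (∑ i, √(twoLevel m δ i * twoLevel m (δ + d) i)) ^ n := by
    have h3 := affinity_twoLevel_ge hm0 hδ0 hd0.le hδ1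
    have h4 : d ^ 2 / (2 * δ) = 1 / (4 * n) := by rw [hd2]; field_simp; norm_num
    rw [h4] at h3
    have h5 : 1 / (4 * (n : ℝ)) ≤ 1 := by
      rw [div_le_one (by positivity)]
      have : (1 : ℝ) ≤ n := by exact_mod_cast hn
      linarith
    have h6 := one_add_mul_le_pow (a := -(1 / (4 * (n : ℝ)))) (by linarith) n
    have h7 : 1 + n * -(1 / (4 * (n : ℝ))) = 3 / 4 := by field_simp; norm_num
    calc (1 : ℝ) / 2 ≤ (1 + -(1 / (4 * (n : ℝ)))) ^ n := by linarith
      _ ≤ _ := by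
        refine pow_le_pow_left₀ (by linarith) ?_ n
        linarith
  have hlm : L / 2 ≤ Real.log m := by
    have h3 : L ≤ Real.log ((m : ℝ) ^ 2) :=
      Real.log_le_log (by positivity) (by push_cast; nlinarith)
    rw [Real.log_pow] at h3
    push_cast at h3
    linarith
  have h3 : d * (L / 2) ≤ |entropy (twoLevel m (δ + d)) - entropy (twoLevel m δ)| := by
    refine le_trans ?_ (le_abs_self _)
    rw [entropy_twoLevel hm0 hδ0, entropy_twoLevel hm0 (by positivity)]
    have h4 := Real.binEntropy_strictMonoOn.monotoneOn (a := δ) (b := δ + d)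
      ⟨hδ0.le, by linarith⟩ ⟨by linarith, by linarith⟩ (by linarith)
    have h5 : d * (L / 2) ≤ d * Real.log m := by gcongr
    linarith
  have h4 : d * (L / 2) * (1 / 2) ≤ 2 * √R := by
    calc d * (L / 2) * (1 / 2) ≤ _ := mul_le_mul h3 h2 (by norm_num) (abs_nonneg _)
      _ ≤ _ := h1
      _ ≤ √R + √R := add_le_add
        (Real.sqrt_le_sqrt (mleRisk_le_mleSupRisk hn (Nat.succ_pos m) hp hpH))
        (Real.sqrt_le_sqrt (mleRisk_le_mleSupRisk hn (Nat.succ_pos m) hq hqH))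
      _ = _ := by ring
  have hR0 : 0 ≤ R := (sq_nonneg _).trans ((sq_bias_le_mleRisk hp).trans
    (mleRisk_le_mleSupRisk hn (Nat.succ_pos m) hp hpH))
  have h5 : (d * (L / 2) * (1 / 2)) ^ 2 ≤ (2 * √R) ^ 2 := by gcongr
  rw [mul_pow, mul_pow, mul_pow, Real.sq_sqrt hR0, hd2] at h5
  have h6 : δ / (2 * n) * (L / 2) ^ 2 * (1 / 2) ^ 2 = 1 / 128 * (H * L / n) := by
    rw [hδ]; field_simp; norm_num
  rw [h6] at h5
  have h7 : 0 ≤ H * L / n := by positivity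
  linarith

end twoLevel

theorem mle_risk_characterization :
    ∃ (H₀ c C : ℝ), 0 < H₀ ∧ 0 < c ∧ c ≤ C ∧
      ∀ (S n : ℕ) (H : ℝ), 2 ≤ S → 2 ≤ n → H₀ ≤ H → H ≤ Real.log S →
        (((S : ℝ) * Real.log S ≤ Real.exp 1 * n * H →
          c * (((S : ℝ) / n) ^ 2 + H * Real.log S / n) ≤ mleSupRisk S n H ∧
            mleSupRisk S n H ≤ C * (((S : ℝ) / n) ^ 2 + H * Real.log S / n)) ∧
        ((S : ℝ) * Real.log S > Real.exp 1 * n * H →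
          c * ((H / Real.log S) * Real.log ((S : ℝ) * Real.log S / (n * H))) ^ 2
              ≤ mleSupRisk S n H ∧
            mleSupRisk S n H ≤
              C * ((H / Real.log S) * Real.log ((S : ℝ) * Real.log S / (n * H))) ^ 2)) := by
  refine ⟨3, 1 / 2000, 400, by norm_num, by norm_num, by norm_num, ?_⟩
  intro S n H hS hn hH hHS
  have hn0 : 0 < n := by omega
  obtain ⟨m, rfl⟩ : ∃ m, S = m + 1 := ⟨S - 1, by omega⟩
  have hm0 : 0 < m := by omega
  have hm2 : 2 ≤ m := by
    by_contra h
    obtain rfl : m = 1 := by omega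
    have := Real.log_two_lt_d9
    norm_num at hHS
    linarith
  have hL0 : 0 < Real.log (m + 1 : ℕ) := by linarith
  have hne : { r | ∃ p : Fin (m + 1) → ℝ, IsDist p ∧ entropy p ≤ H ∧
      r = mleRisk (m + 1) n p }.Nonempty := by
    obtain ⟨-, hd, he⟩ := twoLevel_mem hm0 (by positivity) hH hHS le_rfl
    exact ⟨_, _, hd, he, rfl⟩
  refine ⟨fun h => ⟨?_, csSup_le hne ?_⟩, fun h => ⟨?_, csSup_le hne ?_⟩⟩
  · have h1 := mleSupRisk_ge_bias_dense hm0 hn0 hH hHS h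
    have h2 := mleSupRisk_ge_variance_dense hm2 hn0 hH hHS h
    have h3 : 0 ≤ (((m + 1 : ℕ) : ℝ) / n) ^ 2 := by positivity
    linarith
  · rintro _ ⟨p, hp, hpH, rfl⟩
    refine (mleRisk_le_dense hp hpH hn0 (Nat.succ_pos m) hH hHS).trans ?_
    gcongr
    norm_num
  · refine le_trans ?_ (mleSupRisk_ge_sparse hm0 hn0 hH hHS h)
    gcongr
    norm_num
  · rintro _ ⟨p, hp, hpH, rfl⟩
    exact mleRisk_le_sparse hp hpH hn0 (Nat.succ_pos m) hH hHS h
end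

section
/- For any discrete probability distribution P = (p_1, …, p_S) with alphabet size S ≥ 2, one has ∑_{i=1}^S p_i (ln p_i)² ≤ 2 ln S · (∑_{i=1}^S −p_i ln p_i) + 3. -/
open scoped BigOperators

theorem mul_log_sq_le_two {q : ℝ} (hq : 0 < q) (hq1 : q ≤ 1) : q * Real.log q ^ 2 ≤ 2 := by
  have hu : 0 ≤ -Real.log q := neg_nonneg.2 (Real.log_nonpos hq.le hq1)
  have h := Real.quadratic_le_exp_of_nonneg hu
  rw [Real.exp_neg, Real.exp_log hq] at h
  have h2 : Real.log q ^ 2 ≤ 2 * q⁻¹ := by nlinarith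
  calc q * Real.log q ^ 2 ≤ q * (2 * q⁻¹) := by gcongr
    _ = 2 := by field_simp

theorem mul_log_sq_le {s x : ℝ} (hs : 1 ≤ s) (hx : 0 ≤ x) (hx1 : x ≤ 1) :
    x * Real.log x ^ 2 ≤ 2 * Real.log s * -(x * Real.log x) + 2 / s := by
  have hs0 : 0 < s := by linarith
  rcases hx.eq_or_lt with rfl | hx0
  · simp; positivity
  have hlog : Real.log (s * x) = Real.log s + Real.log x := Real.log_mul hs0.ne' hx0.ne'
  have hL : 0 ≤ Real.log s := Real.log_nonneg hs
  have hlx : Real.log x ≤ 0 := Real.log_nonpos hx hx1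
  rcases le_total (s * x) 1 with h | h
  · have key := mul_log_sq_le_two (mul_pos hs0 hx0) h
    have h2 : x * Real.log (s * x) ^ 2 ≤ 2 / s := by
      rw [le_div_iff₀ hs0]; linarith
    rw [hlog] at h2
    nlinarith [mul_nonneg hx (sq_nonneg (Real.log s))]
  · have h0 : 0 ≤ Real.log s + Real.log x := hlog ▸ Real.log_nonneg h
    have h1 : 0 ≤ x * (-Real.log x * (2 * Real.log s + Real.log x)) :=
      mul_nonneg hx (mul_nonneg (by linarith) (by linarith))
    have h2 : 0 ≤ 2 / s := by positivity
    nlinarith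

theorem varentropy_bound (S : ℕ) (hS : 2 ≤ S) (p : Fin S → ℝ)
    (hp : ∀ i, 0 ≤ p i) (hsum : ∑ i, p i = 1) :
    ∑ i, p i * (Real.log (p i)) ^ 2
      ≤ 2 * Real.log S * (∑ i, -(p i * Real.log (p i))) + 3 := by
  have hS1 : (1 : ℝ) ≤ S := by exact_mod_cast (by omega : 1 ≤ S)
  have hp1 (i : Fin S) : p i ≤ 1 :=
    hsum ▸ Finset.single_le_sum (fun j _ ↦ hp j) (Finset.mem_univ i)
  calc ∑ i, p i * (Real.log (p i)) ^ 2
      ≤ ∑ i, (2 * Real.log S * -(p i * Real.log (p i)) + 2 / (S : ℝ)) :=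
        Finset.sum_le_sum fun i _ ↦ mul_log_sq_le hS1 (hp i) (hp1 i)
    _ = 2 * Real.log S * (∑ i, -(p i * Real.log (p i))) + 2 := by
        rw [Finset.sum_add_distrib, ← Finset.mul_sum, Finset.sum_const, Finset.card_univ,
          Fintype.card_fin, nsmul_eq_mul, mul_div_cancel₀ _ (by positivity)]
    _ ≤ _ := by linarith
end

section
/- For any positive integer n and any p ∈ [0, 1], if p̂ = X/n with X ∼ Binomial(n, p), then −p ln p − E[−p̂ ln p̂] ≥ −p ln(np); equivalently, E[−p̂ ln p̂] ≤ p ln n. -/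
open scoped BigOperators

/-- Binomial probability mass `C(n,k) p^k (1-p)^{n-k}`. -/
noncomputable def binomP (n : ℕ) (p : ℝ) (k : ℕ) : ℝ :=
  (n.choose k : ℝ) * p ^ k * (1 - p) ^ (n - k)

/-- `E[-p̂ ln p̂]` where `p̂ = X/n` and `X ∼ Binomial(n, p)` (convention `0 ln 0 = 0`). -/
noncomputable def expMLEEntropyTerm (n : ℕ) (p : ℝ) : ℝ :=
  ∑ k ∈ Finset.range (n + 1),
    binomP n p k * (-(((k : ℝ) / n) * Real.log ((k : ℝ) / n)))

theorem binomP_nonneg (n : ℕ) {p : ℝ} (hp0 : 0 ≤ p) (hp1 : p ≤ 1) (k : ℕ) :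
    0 ≤ binomP n p k := by
  have : 0 ≤ 1 - p := sub_nonneg.2 hp1
  unfold binomP
  positivity

theorem sum_binomP_mul_natCast (n : ℕ) (p : ℝ) :
    ∑ k ∈ Finset.range (n + 1), binomP n p k * (k : ℝ) = n * p := by
  have h := congrArg (Polynomial.eval p) (bernsteinPolynomial.sum_smul ℝ n)
  simp only [Polynomial.eval_finsetSum, bernsteinPolynomial, nsmul_eq_mul, Polynomial.eval_mul,
    Polynomial.eval_natCast, Polynomial.eval_pow, Polynomial.eval_X, Polynomial.eval_sub,
    Polynomial.eval_one] at h
  rw [← h]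
  exact Finset.sum_congr rfl fun k _ => mul_comm _ _

theorem neg_div_mul_log_div_le (n k : ℕ) (hn : 0 < n) :
    -(((k : ℝ) / n) * Real.log ((k : ℝ) / n)) ≤ (k : ℝ) / n * Real.log n := by
  rcases Nat.eq_zero_or_pos k with rfl | hk
  · simp
  · rw [Real.log_div (by positivity) (by positivity)]
    have : 0 ≤ (k : ℝ) / n * Real.log k := mul_nonneg (by positivity) (Real.log_natCast_nonneg k)
    linarith

theorem expMLEEntropyTerm_le (n : ℕ) (hn : 0 < n) {p : ℝ} (hp0 : 0 ≤ p) (hp1 : p ≤ 1) :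
    expMLEEntropyTerm n p ≤ p * Real.log n := by
  have hn' : (n : ℝ) ≠ 0 := by positivity
  calc expMLEEntropyTerm n p
      ≤ ∑ k ∈ Finset.range (n + 1), binomP n p k * ((k : ℝ) / n * Real.log n) :=
        Finset.sum_le_sum fun k _ => mul_le_mul_of_nonneg_left (neg_div_mul_log_div_le n k hn)
          (binomP_nonneg n hp0 hp1 k)
    _ = (∑ k ∈ Finset.range (n + 1), binomP n p k * (k : ℝ)) * (Real.log n / n) := by
        rw [Finset.sum_mul]
        exact Finset.sum_congr rfl fun k _ => by ring
    _ = p * Real.log n := by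
        rw [sum_binomP_mul_natCast]
        field_simp

theorem mle_bias_lower_bound_simple (n : ℕ) (hn : 0 < n) (p : ℝ)
    (hp0 : 0 ≤ p) (hp1 : p ≤ 1) :
    -(p * Real.log p) - expMLEEntropyTerm n p ≥ -(p * Real.log ((n : ℝ) * p)) ∧
      expMLEEntropyTerm n p ≤ p * Real.log n := by
  have h := expMLEEntropyTerm_le n hn hp0 hp1
  refine ⟨?_, h⟩
  rcases hp0.eq_or_lt with rfl | hp
  · simpa using h
  · rw [Real.log_mul (by positivity) hp.ne']
    linarith
end

section
/- For any positive integer n and any p with 15/n ≤ p ≤ 1, if p̂ = X/n with X ∼ Binomial(n, p), then −p ln p − E[−p̂ ln p̂] ≥ (1−p)/(2n) + 1/(20 n² p) − p/(12 n²). -/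
open scoped BigOperators

theorem binomP_succ_zero (n : ℕ) (p : ℝ) :
    binomP (n + 1) p 0 = (1 - p) * binomP n p 0 := by
  simp [binomP, pow_succ']

theorem binomP_succ_succ (n : ℕ) (p : ℝ) (k : ℕ) :
    binomP (n + 1) p (k + 1) = p * binomP n p k + (1 - p) * binomP n p (k + 1) := by
  unfold binomP
  rw [Nat.choose_succ_succ, Nat.add_sub_add_right]
  push_cast
  rcases lt_or_ge k n with h | h
  · obtain ⟨m, rfl⟩ : ∃ m, n = k + 1 + m := ⟨n - (k + 1), by omega⟩
    rw [show k + 1 + m - k = m + 1 by omega, show k + 1 + m - (k + 1) = m by omega]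
    ring
  · rw [Nat.choose_eq_zero_of_lt (show n < k + 1 by omega)]
    push_cast
    ring

/-- The expectation of `g X` for `X ∼ Binomial(n, p)`. -/
noncomputable def binomExp (n : ℕ) (p : ℝ) (g : ℕ → ℝ) : ℝ :=
  ∑ k ∈ Finset.range (n + 1), binomP n p k * g k

theorem binomExp_mono (n : ℕ) {p : ℝ} (hp0 : 0 ≤ p) (hp1 : p ≤ 1) {f g : ℕ → ℝ}
    (h : ∀ k, f k ≤ g k) : binomExp n p f ≤ binomExp n p g :=
  Finset.sum_le_sum fun k _ => mul_le_mul_of_nonneg_left (h k) (binomP_nonneg n hp0 hp1 k)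

theorem binomExp_succ (n : ℕ) (p : ℝ) (g : ℕ → ℝ) :
    binomExp (n + 1) p g
      = p * binomExp n p (fun k => g (k + 1)) + (1 - p) * binomExp n p g := by
  have key : ∑ k ∈ Finset.range (n + 1), binomP n p (k + 1) * g (k + 1) + binomP n p 0 * g 0
      = ∑ k ∈ Finset.range (n + 1), binomP n p k * g k := by
    rw [← Finset.sum_range_succ' (fun k => binomP n p k * g k), Finset.sum_range_succ]
    simp [binomP]
  unfold binomExp
  rw [Finset.sum_range_succ', binomP_succ_zero, ← key]
  simp only [binomP_succ_succ, add_mul, Finset.sum_add_distrib, mul_add, Finset.mul_sum, mul_assoc]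
  ring

/-- The total mass and the first five central moments of the binomial distribution, in the form
of the expectation of an arbitrary quintic polynomial in `X - n p`. -/
theorem binomExp_quintic_central (n : ℕ) (p : ℝ) (a₀ a₁ a₂ a₃ a₄ a₅ : ℝ) :
    binomExp n p (fun k => a₀ + a₁ * (k - n * p) + a₂ * (k - n * p) ^ 2 + a₃ * (k - n * p) ^ 3
        + a₄ * (k - n * p) ^ 4 + a₅ * (k - n * p) ^ 5)
      = a₀ + a₂ * (n * p * (1 - p)) + a₃ * (n * p * (1 - p) * (1 - 2 * p))
        + a₄ * (n * p * (1 - p) * (1 - 6 * p * (1 - p)) + 3 * (n * p * (1 - p)) ^ 2)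
        + a₅ * (n * p * (1 - p) * (1 - 2 * p) * (1 - 12 * p * (1 - p))
          + 10 * (n * p * (1 - p)) ^ 2 * (1 - 2 * p)) := by
  induction n generalizing a₀ a₁ a₂ a₃ a₄ a₅ with
  | zero => simp [binomExp, binomP]
  | succ n ih =>
    have shift (c : ℝ) (g : ℕ → ℝ) (hg : ∀ k, g k = a₀ + a₁ * (k - n * p + c)
        + a₂ * (k - n * p + c) ^ 2 + a₃ * (k - n * p + c) ^ 3
        + a₄ * (k - n * p + c) ^ 4 + a₅ * (k - n * p + c) ^ 5) :
        binomExp n p g = _ :=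
      (congrArg (binomExp n p) (funext fun k => by rw [hg]; ring)).trans
        (ih (a₀ + a₁ * c + a₂ * c ^ 2 + a₃ * c ^ 3 + a₄ * c ^ 4 + a₅ * c ^ 5)
          (a₁ + 2 * a₂ * c + 3 * a₃ * c ^ 2 + 4 * a₄ * c ^ 3 + 5 * a₅ * c ^ 4)
          (a₂ + 3 * a₃ * c + 6 * a₄ * c ^ 2 + 10 * a₅ * c ^ 3)
          (a₃ + 4 * a₄ * c + 10 * a₅ * c ^ 2) (a₄ + 5 * a₅ * c) a₅)
    rw [binomExp_succ, shift (1 - p) _ fun k => by push_cast; ring,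
      shift (-p) _ fun k => by push_cast; ring]
    push_cast
    ring

/-- The degree five Taylor polynomial of `(1 + t) log (1 + t)` at `0`. -/
noncomputable def mulLogTaylor (t : ℝ) : ℝ :=
  t + t ^ 2 / 2 - t ^ 3 / 6 + t ^ 4 / 12 - t ^ 5 / 20

theorem hasDerivAt_log_sub_mulLogTaylor_div {y : ℝ} (hy : 0 < y) :
    HasDerivAt (fun y => Real.log y - mulLogTaylor (y - 1) / y) ((y - 1) ^ 5 / (5 * y ^ 2)) y := by
  have ht : HasDerivAt (fun y : ℝ => y - 1) 1 y := (hasDerivAt_id y).sub_const 1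
  have hP : HasDerivAt (fun y : ℝ => mulLogTaylor (y - 1)) _ y :=
    ((((ht.add ((ht.pow 2).div_const 2)).sub ((ht.pow 3).div_const 6)).add
      ((ht.pow 4).div_const 12)).sub ((ht.pow 5).div_const 20))
  refine ((Real.hasDerivAt_log hy.ne').sub (hP.div (hasDerivAt_id y) hy.ne')).congr_deriv ?_
  simp only [mulLogTaylor, id]
  push_cast
  field_simp
  ring

theorem mulLogTaylor_le_mul_log {y : ℝ} (hy : 0 ≤ y) :
    mulLogTaylor (y - 1) ≤ y * Real.log y := by
  rcases hy.eq_or_lt with rfl | hy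
  · norm_num [mulLogTaylor]
  suffices h : 0 ≤ Real.log y - mulLogTaylor (y - 1) / y by
    rw [sub_nonneg, div_le_iff₀ hy] at h
    linarith
  have hone : Real.log 1 - mulLogTaylor (1 - 1) / 1 = 0 := by norm_num [mulLogTaylor]
  rw [← hone]
  rcases le_total y 1 with h1 | h1
  · have hpos : ∀ x ∈ Set.Icc y 1, 0 < x := fun x hx => hy.trans_le hx.1
    refine antitoneOn_of_deriv_nonpos (convex_Icc y 1)
      (f := fun y => Real.log y - mulLogTaylor (y - 1) / y)
      (fun x hx => (hasDerivAt_log_sub_mulLogTaylor_div (hpos x hx)).continuousAt.continuousWithinAt)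
      (fun x hx => (hasDerivAt_log_sub_mulLogTaylor_div
        (hpos x (interior_subset hx))).differentiableAt.differentiableWithinAt)
      (fun x hx => ?_) (Set.left_mem_Icc.2 h1) (Set.right_mem_Icc.2 h1) h1
    have hx' := interior_subset hx
    rw [(hasDerivAt_log_sub_mulLogTaylor_div (hpos x hx')).deriv]
    exact div_nonpos_of_nonpos_of_nonneg
      (Odd.pow_nonpos (by decide) (sub_nonpos.2 hx'.2)) (by positivity)
  · have hpos : ∀ x ∈ Set.Icc 1 y, 0 < x := fun x hx => one_pos.trans_le hx.1
    refine monotoneOn_of_deriv_nonneg (convex_Icc 1 y)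
      (f := fun y => Real.log y - mulLogTaylor (y - 1) / y)
      (fun x hx => (hasDerivAt_log_sub_mulLogTaylor_div (hpos x hx)).continuousAt.continuousWithinAt)
      (fun x hx => (hasDerivAt_log_sub_mulLogTaylor_div
        (hpos x (interior_subset hx))).differentiableAt.differentiableWithinAt)
      (fun x hx => ?_) (Set.left_mem_Icc.2 h1) (Set.right_mem_Icc.2 h1) h1
    have hx' := interior_subset hx
    rw [(hasDerivAt_log_sub_mulLogTaylor_div (hpos x hx')).deriv]
    exact div_nonneg (pow_nonneg (sub_nonneg.2 hx'.1) 5) (by positivity)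

theorem mul_log_add_mulLogTaylor_le {p x : ℝ} (hp : 0 < p) (hx : 0 ≤ x) :
    x * Real.log p + p * mulLogTaylor (x / p - 1) ≤ x * Real.log x := by
  rcases hx.eq_or_lt with rfl | hx'
  · norm_num [mulLogTaylor]
    linarith
  have h := mul_le_mul_of_nonneg_left (mulLogTaylor_le_mul_log (div_nonneg hx hp.le)) hp.le
  rw [Real.log_div hx'.ne' hp.ne', ← mul_assoc, mul_div_cancel₀ _ hp.ne'] at h
  linarith

theorem quintic_remainder_nonneg {l p : ℝ} (hl : 15 ≤ l) (hp0 : 0 ≤ p) (hp1 : p ≤ 1) :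
    0 ≤ l ^ 2 / 30 + l * ((1 - p) * (1 - 6 * (1 - p) ^ 2) / 12)
      - (1 - p) * (1 - 2 * p) * (1 - 12 * p * (1 - p)) / 20 := by
  have h1 : -5 ≤ (1 - p) * (1 - 6 * (1 - p) ^ 2) := by
    nlinarith [mul_nonneg hp0 (sub_nonneg.2 hp1), sq_nonneg p,
      mul_nonneg (mul_nonneg hp0 hp0) (sub_nonneg.2 hp1)]
  have hab : |(1 - p) * (1 - 2 * p) * (1 - 12 * p * (1 - p))| ≤ 1 * 1 * 2 := by
    rw [abs_mul, abs_mul]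
    gcongr
    · rw [abs_le]; constructor <;> linarith
    · rw [abs_le]; constructor <;> linarith
    · rw [abs_le]; constructor <;> nlinarith [sq_nonneg (2 * p - 1)]
  have h2 := (le_abs_self _).trans hab
  nlinarith [mul_le_mul_of_nonneg_left h1 (by linarith : (0 : ℝ) ≤ l)]

theorem mle_bias_lower_bound (n : ℕ) (hn : 0 < n) (p : ℝ)
    (hp0 : 15 / (n : ℝ) ≤ p) (hp1 : p ≤ 1) :
    -(p * Real.log p) - expMLEEntropyTerm n p
      ≥ (1 - p) / (2 * n) + 1 / (20 * (n : ℝ) ^ 2 * p) - p / (12 * (n : ℝ) ^ 2) := by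
  have hn' : (0 : ℝ) < n := by exact_mod_cast hn
  have hp : 0 < p := lt_of_lt_of_le (by positivity) hp0
  have hl : 15 ≤ n * p := by rwa [div_le_iff₀ hn', mul_comm] at hp0
  have hent : expMLEEntropyTerm n p
      = -binomExp n p (fun k => (k : ℝ) / n * Real.log ((k : ℝ) / n)) := by
    simp [expMLEEntropyTerm, binomExp]
  have hmono := binomExp_mono n hp.le hp1 fun k =>
    mul_log_add_mulLogTaylor_le hp (show (0 : ℝ) ≤ (k : ℝ) / n by positivity)
  have hpoly : (fun k : ℕ => (k : ℝ) / n * Real.log p + p * mulLogTaylor ((k : ℝ) / n / p - 1))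
      = fun k : ℕ => p * Real.log p + (Real.log p / n + 1 / n) * ((k : ℝ) - n * p)
        + p / (2 * (n * p) ^ 2) * ((k : ℝ) - n * p) ^ 2
        + -(p / (6 * (n * p) ^ 3)) * ((k : ℝ) - n * p) ^ 3
        + p / (12 * (n * p) ^ 4) * ((k : ℝ) - n * p) ^ 4
        + -(p / (20 * (n * p) ^ 5)) * ((k : ℝ) - n * p) ^ 5 := by
    funext k
    have ht : (k : ℝ) / n / p - 1 = ((k : ℝ) - n * p) / (n * p) := by field_simp
    rw [ht, mulLogTaylor]
    field_simp
    ring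
  rw [hpoly, binomExp_quintic_central] at hmono
  have hrem := div_nonneg (quintic_remainder_nonneg hl hp.le hp1)
    (show 0 ≤ (n : ℝ) * (n * p) ^ 3 by positivity)
  have hid : p * Real.log p + p / (2 * (n * p) ^ 2) * (n * p * (1 - p))
        + -(p / (6 * (n * p) ^ 3)) * (n * p * (1 - p) * (1 - 2 * p))
        + p / (12 * (n * p) ^ 4)
          * (n * p * (1 - p) * (1 - 6 * p * (1 - p)) + 3 * (n * p * (1 - p)) ^ 2)
        + -(p / (20 * (n * p) ^ 5)) * (n * p * (1 - p) * (1 - 2 * p) * (1 - 12 * p * (1 - p))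
          + 10 * (n * p * (1 - p)) ^ 2 * (1 - 2 * p))
      = p * Real.log p
        + ((1 - p) / (2 * n) + 1 / (20 * (n : ℝ) ^ 2 * p) - p / (12 * (n : ℝ) ^ 2))
        + ((n * p) ^ 2 / 30 + n * p * ((1 - p) * (1 - 6 * (1 - p) ^ 2) / 12)
          - (1 - p) * (1 - 2 * p) * (1 - 12 * p * (1 - p)) / 20) / (n * (n * p) ^ 3) := by
    field_simp
    ring
  rw [hent]
  linarith
end

section
/- Let P_{θ_0} and P_{θ_1} be probability measures on a measurable space (Z, A) and let T_0, T_1 ∈ ℝ. Then for every measurable estimator T̂ : Z → ℝ, max{ P_{θ_0}(|T̂ − T_0| ≥ |T_1 − T_0|/2), P_{θ_1}(|T̂ − T_1| ≥ |T_1 − T_0|/2) } ≥ (1/4)·exp(−D(P_{θ_1} ‖ P_{θ_0})), where D denotes the Kullback–Leibler divergence (equal to ∫ ln(dP/dQ) dP when P ≪ Q and +∞ otherwise). -/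
open MeasureTheory
open scoped ENNReal Classical

/-- Kullback–Leibler divergence `D(P‖Q)`: equal to `∫ ln(dP/dQ) dP` when `P ≪ Q`
(and this log-likelihood ratio is integrable), and `+∞` otherwise. -/
noncomputable def klDiv {Ω : Type*} [MeasurableSpace Ω] (P Q : Measure Ω) : ℝ≥0∞ :=
  if P ≪ Q ∧ Integrable (llr P Q) P then ENNReal.ofReal (∫ x, llr P Q x ∂P) else ⊤

/-- The Donsker–Varadhan inequality. -/
lemma integral_le_integral_llr_add_log_integral_exp {Ω : Type*} [MeasurableSpace Ω]
    {μ ν : Measure Ω} [IsProbabilityMeasure μ] [IsProbabilityMeasure ν] {f : Ω → ℝ}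
    (hμν : μ ≪ ν) (h_int : Integrable (llr μ ν) μ) (hfμ : Integrable f μ)
    (hfν : Integrable (fun x ↦ Real.exp (f x)) ν) :
    ∫ x, f x ∂μ ≤ ∫ x, llr μ ν x ∂μ + Real.log (∫ x, Real.exp (f x) ∂ν) := by
  have := isProbabilityMeasure_tilted hfν
  have h := InformationTheory.integral_llr_add_sub_measure_univ_nonneg
    (hμν.trans (absolutelyContinuous_tilted hfν)) (integrable_llr_tilted_right hμν hfμ h_int hfν)
  rw [integral_llr_tilted_right hμν hfμ hfν h_int] at h
  simp only [probReal_univ] at h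
  linarith

/-- A form of the Bretagnolle–Huber inequality. -/
lemma exp_neg_integral_llr_le {Ω : Type*} [MeasurableSpace Ω]
    {μ ν : Measure Ω} [IsProbabilityMeasure μ] [IsProbabilityMeasure ν]
    (hμν : μ ≪ ν) (h_int : Integrable (llr μ ν) μ) {s : Set Ω} (hs : MeasurableSet s)
    (hνs : ν s ≠ 0) :
    Real.exp (-∫ x, llr μ ν x ∂μ) ≤ 2 * (ν.real s + (1 - μ.real s)) := by
  have hq : 0 < ν.real s := ENNReal.toReal_pos hνs (measure_ne_top ν s)
  have hq1 : ν.real s ≤ 1 := measureReal_le_one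
  have hp : 0 ≤ μ.real s := measureReal_nonneg
  have hp1 : μ.real s ≤ 1 := measureReal_le_one
  have hexp : (fun x ↦ Real.exp (s.indicator (fun _ ↦ -Real.log (ν.real s)) x)) =
      fun x ↦ 1 + s.indicator (fun _ ↦ (ν.real s)⁻¹ - 1) x := by
    funext x
    by_cases hx : x ∈ s <;> simp [hx, Real.exp_neg, Real.exp_log hq]
  have hfν : Integrable (fun x ↦ 1 + s.indicator (fun _ ↦ (ν.real s)⁻¹ - 1) x) ν :=
    (integrable_const _).add ((integrable_const _).indicator hs)
  have hint : ∫ x, (1 + s.indicator (fun _ ↦ (ν.real s)⁻¹ - 1) x) ∂ν = 2 - ν.real s := by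
    rw [integral_add (integrable_const _) ((integrable_const _).indicator hs),
      integral_indicator_const _ hs]
    simp only [integral_const, probReal_univ, smul_eq_mul]
    field_simp
    ring
  have h := integral_le_integral_llr_add_log_integral_exp
    (f := s.indicator (fun _ ↦ -Real.log (ν.real s))) hμν h_int
    ((integrable_const _).indicator hs) (hexp ▸ hfν)
  rw [hexp, hint, integral_indicator_const _ hs, smul_eq_mul] at h
  have hgm : ν.real s ^ μ.real s ≤ μ.real s * ν.real s + (1 - μ.real s) := by
    simpa using Real.geom_mean_le_arith_mean2_weighted hp (sub_nonneg.2 hp1) hq.le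
      zero_le_one (add_sub_cancel _ _)
  calc Real.exp (-∫ x, llr μ ν x ∂μ)
    _ ≤ Real.exp (Real.log (ν.real s) * μ.real s + Real.log (2 - ν.real s)) := by
      gcongr
      linarith
    _ = ν.real s ^ μ.real s * (2 - ν.real s) := by
      rw [Real.exp_add, Real.exp_log (by linarith), Real.rpow_def_of_pos hq]
    _ ≤ (ν.real s + (1 - μ.real s)) * 2 := by
      gcongr
      · linarith
      · nlinarith
      · linarith
    _ = 2 * (ν.real s + (1 - μ.real s)) := mul_comm _ _

theorem le_cam_two_point {Ω : Type*} [MeasurableSpace Ω]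
    (P₀ P₁ : Measure Ω) [IsProbabilityMeasure P₀] [IsProbabilityMeasure P₁]
    (T₀ T₁ : ℝ) (T : Ω → ℝ) (hT : Measurable T) :
    (if klDiv P₁ P₀ = ⊤ then (0 : ℝ≥0∞)
      else ENNReal.ofReal ((1 / 4) * Real.exp (-(klDiv P₁ P₀).toReal)))
      ≤ max (P₀ {z | |T z - T₀| ≥ |T₁ - T₀| / 2}) (P₁ {z | |T z - T₁| ≥ |T₁ - T₀| / 2}) := by
  have hA : MeasurableSet {z | |T z - T₀| ≥ |T₁ - T₀| / 2} :=
    measurableSet_le measurable_const (by fun_prop)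
  have hAB : {z | |T z - T₀| ≥ |T₁ - T₀| / 2}ᶜ ⊆ {z | |T z - T₁| ≥ |T₁ - T₀| / 2} := by
    intro z hz
    simp only [Set.mem_compl_iff, Set.mem_ofPred_eq, ge_iff_le, not_le] at hz ⊢
    have := abs_sub_le T₁ (T z) T₀
    rw [abs_sub_comm T₁ (T z)] at this
    linarith
  generalize {z | |T z - T₀| ≥ |T₁ - T₀| / 2} = A at hA hAB ⊢
  generalize {z | |T z - T₁| ≥ |T₁ - T₀| / 2} = B at hAB ⊢
  split_ifs with hD
  · exact zero_le
  obtain ⟨hac, hint⟩ : P₁ ≪ P₀ ∧ Integrable (llr P₁ P₀) P₁ := by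
    by_contra h
    exact hD (if_neg h)
  have hK : 0 ≤ ∫ x, llr P₁ P₀ x ∂P₁ := by
    simpa using InformationTheory.integral_llr_add_sub_measure_univ_nonneg hac hint
  have hKL : (klDiv P₁ P₀).toReal = ∫ x, llr P₁ P₀ x ∂P₁ := by
    rw [klDiv, if_pos ⟨hac, hint⟩, ENNReal.toReal_ofReal hK]
  have hB : 1 - P₁.real A ≤ P₁.real B := by
    rw [← probReal_compl_eq_one_sub hA]
    exact measureReal_mono hAB
  have hsum : Real.exp (-∫ x, llr P₁ P₀ x ∂P₁) ≤ 2 * (P₀.real A + P₁.real B) := by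
    by_cases h0 : P₀ A = 0
    · have h1 : P₁.real A = 0 := by simp [measureReal_def, hac h0]
      have h2 : Real.exp (-∫ x, llr P₁ P₀ x ∂P₁) ≤ 1 := Real.exp_le_one_iff.2 (by linarith)
      have h3 : 0 ≤ P₀.real A := measureReal_nonneg
      linarith
    · exact (exp_neg_integral_llr_le hac hint hA h0).trans (by linarith)
  rw [hKL, ← ofReal_measureReal (μ := P₀), ← ofReal_measureReal (μ := P₁), ← ENNReal.ofReal_max]
  refine ENNReal.ofReal_le_ofReal ?_
  have h0 := le_max_left (P₀.real A) (P₁.real B)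
  have h1 := le_max_right (P₀.real A) (P₁.real B)
  linarith
end

section
/- For any 0 < η < 1 and any positive integer L, there exist two Borel probability measures ν_0 and ν_1 supported on [η, 1] such that (i) ∫ t^l dν_1(t) = ∫ t^l dν_0(t) for all l = 0, 1, …, L, and (ii) ∫ (−ln t) dν_1(t) − ∫ (−ln t) dν_0(t) = 2·E_L[−ln x]_{[η,1]}. -/
open scoped BigOperators

/-- The uniform (sup-norm) error of approximating `f` by the polynomial `q` on `[a,b]`. -/
noncomputable def uniformErr (f : ℝ → ℝ) (a b : ℝ) (q : Polynomial ℝ) : ℝ :=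
  sSup ((fun x => |f x - q.eval x|) '' Set.Icc a b)

/-- `E_L[f]_{[a,b]}`: the best uniform approximation error of `f` on `[a,b]`
by polynomials of degree at most `L`. -/
noncomputable def bestApproxErr (L : ℕ) (f : ℝ → ℝ) (a b : ℝ) : ℝ :=
  sInf { e | ∃ q : Polynomial ℝ, q.natDegree ≤ L ∧ e = uniformErr f a b q }

open MeasureTheory Set

/-- In a finite-dimensional space, the convex hull of a compact set is compact. -/
theorem IsCompact.convexHull_of_finiteDimensional {E : Type*} [NormedAddCommGroup E]
    [NormedSpace ℝ E] [FiniteDimensional ℝ E] {s : Set E} (hs : IsCompact s) :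
    IsCompact (convexHull ℝ s) := by
  have key : convexHull ℝ s = ⋃ n ∈ Set.Iic (Module.finrank ℝ E + 1),
      (fun p : (Fin n → ℝ) × (Fin n → E) => ∑ i, p.1 i • p.2 i) ''
        (stdSimplex ℝ (Fin n) ×ˢ Set.univ.pi fun _ => s) := by
    apply Subset.antisymm
    · intro x hx
      obtain ⟨ι, _, z, w, hz, hind, hw, hw1, hx⟩ := eq_pos_convex_span_of_mem_convexHull hx
      have hcard : Fintype.card ι ≤ Module.finrank ℝ E + 1 :=
        hind.card_le_finrank_succ.trans
          (Nat.add_le_add_right (Submodule.finrank_le _) 1)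
      let e := (Fintype.equivFin ι).symm
      refine mem_biUnion (show Fintype.card ι ∈ Set.Iic _ from hcard)
        ⟨(w ∘ e, z ∘ e), ⟨⟨fun i => (hw _).le, ?_⟩, fun i _ => hz ⟨_, rfl⟩⟩, ?_⟩
      · exact (e.sum_comp w).trans hw1
      · exact (e.sum_comp fun i => w i • z i).trans hx
    · refine iUnion₂_subset fun n _ => ?_
      rintro _ ⟨⟨w, z⟩, ⟨hw, hz⟩, rfl⟩
      exact mem_convexHull_of_exists_fintype w z hw.1 hw.2 (fun i => hz i trivial) rfl
  rw [key]
  refine (Set.finite_Iic _).isCompact_biUnion fun n _ => ?_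
  refine ((isCompact_stdSimplex ℝ (Fin n)).prod (isCompact_univ_pi fun _ => hs)).image ?_
  fun_prop

/-- A point in the convex hull of a curve is the vector of integrals of the curve against a
finitely supported probability measure. -/
theorem exists_probabilityMeasure_of_mem_convexHull_image {E : Type*} [NormedAddCommGroup E]
    [NormedSpace ℝ E] {φ : ℝ → E} {s : Set ℝ} {x : E} (hs : MeasurableSet s)
    (hx : x ∈ convexHull ℝ (φ '' s)) :
    ∃ ν : Measure ℝ, IsProbabilityMeasure ν ∧ ν sᶜ = 0 ∧
      ∀ g : E →L[ℝ] ℝ, ∫ t, g (φ t) ∂ν = g x := by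
  obtain ⟨ι, _, w, z, hw, hw1, hz, rfl⟩ := mem_convexHull_iff_exists_fintype.1 hx
  choose t ht htz using hz
  refine ⟨∑ i, ENNReal.ofReal (w i) • Measure.dirac (t i), ⟨?_⟩, ?_, fun g => ?_⟩
  · simp [← ENNReal.ofReal_sum_of_nonneg fun i _ => hw i, hw1]
  · simp only [Measure.coe_finsetSum, Measure.coe_smul, Finset.sum_apply, Pi.smul_apply, smul_eq_mul]
    refine Finset.sum_eq_zero fun i _ => ?_
    simp [Measure.dirac_apply' _ hs.compl, ht i]
  · rw [integral_finsetSum_measure fun i _ =>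
      (integrable_dirac (by simp)).smul_measure ENNReal.ofReal_ne_top]
    simp [integral_smul_measure, hw, htz]

theorem uniformErr_nonneg (f : ℝ → ℝ) (a b : ℝ) (q : Polynomial ℝ) : 0 ≤ uniformErr f a b q :=
  Real.sSup_nonneg (by rintro _ ⟨x, _, rfl⟩; exact abs_nonneg _)

theorem bestApproxErr_nonneg (L : ℕ) (f : ℝ → ℝ) (a b : ℝ) : 0 ≤ bestApproxErr L f a b :=
  Real.sInf_nonneg (by rintro _ ⟨q, _, rfl⟩; exact uniformErr_nonneg f a b q)

theorem bestApproxErr_le {L : ℕ} {f : ℝ → ℝ} {a b r : ℝ} (q : Polynomial ℝ)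
    (hq : q.natDegree ≤ L) (hr : 0 ≤ r) (h : ∀ x ∈ Icc a b, |f x - q.eval x| ≤ r) :
    bestApproxErr L f a b ≤ r := by
  have hle : bestApproxErr L f a b ≤ uniformErr f a b q := by
    refine csInf_le ⟨0, ?_⟩ ⟨q, hq, rfl⟩
    rintro _ ⟨q, _, rfl⟩; exact uniformErr_nonneg f a b q
  refine hle.trans (Real.sSup_le ?_ hr)
  rintro _ ⟨x, hx, rfl⟩; exact h x hx

/-- If `f - q` oscillates by at most `u` on `[a,b]`, then shifting `q` by a constant approximates
`f` within `u / 2`. -/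
theorem two_mul_bestApproxErr_le_of_oscillation {L : ℕ} {f : ℝ → ℝ} {a b u : ℝ} (hab : a ≤ b)
    (hf : ContinuousOn f (Icc a b)) (q : Polynomial ℝ) (hq : q.natDegree ≤ L)
    (h : ∀ x ∈ Icc a b, ∀ y ∈ Icc a b, (f x - q.eval x) - (f y - q.eval y) ≤ u) :
    2 * bestApproxErr L f a b ≤ u := by
  have hc : ContinuousOn (fun x => f x - q.eval x) (Icc a b) := hf.sub q.continuousOn
  obtain ⟨x, hx, hmax⟩ := isCompact_Icc.exists_isMaxOn (nonempty_Icc.2 hab) hc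
  obtain ⟨y, hy, hmin⟩ := isCompact_Icc.exists_isMinOn (nonempty_Icc.2 hab) hc
  have hu : 0 ≤ u := by simpa using h x hx x hx
  suffices bestApproxErr L f a b ≤ u / 2 by linarith
  refine bestApproxErr_le
    (q + Polynomial.C (((f x - q.eval x) + (f y - q.eval y)) / 2)) ?_ (by linarith) ?_
  · simpa using hq
  · intro t ht
    have h1 : f t - q.eval t ≤ f x - q.eval x := hmax ht
    have h2 : f y - q.eval y ≤ f t - q.eval t := hmin ht
    have h3 := h x hx y hy
    rw [Polynomial.eval_add, Polynomial.eval_C, abs_le]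
    constructor <;> linarith

/-- The moment curve of degree `L`, augmented by the graph coordinate of `f`. -/
def momentCurve (L : ℕ) (f : ℝ → ℝ) (t : ℝ) : (Fin (L + 1) → ℝ) × ℝ :=
  (fun i => t ^ (i : ℕ), f t)

theorem continuousOn_momentCurve (L : ℕ) {f : ℝ → ℝ} {s : Set ℝ} (hf : ContinuousOn f s) :
    ContinuousOn (momentCurve L f) s := by
  unfold momentCurve
  fun_prop

/-- A linear functional along the moment curve is a polynomial plus a multiple of `f`. -/
theorem exists_polynomial_apply_momentCurve (L : ℕ) (f : ℝ → ℝ)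
    (g : ((Fin (L + 1) → ℝ) × ℝ) →L[ℝ] ℝ) :
    ∃ p : Polynomial ℝ, p.natDegree ≤ L ∧
      ∀ t, g (momentCurve L f t) = p.eval t + f t * g (0, 1) := by
  refine ⟨∑ i : Fin (L + 1), Polynomial.monomial (i : ℕ) (g (Pi.single i 1, 0)), ?_, fun t => ?_⟩
  · exact Polynomial.natDegree_sum_le_of_forall_le _ _ fun i _ =>
      (Polynomial.natDegree_monomial_le _).trans (Nat.lt_succ_iff.1 i.2)
  · have hsplit : momentCurve L f t =
        ∑ i : Fin (L + 1), (t ^ (i : ℕ)) • ((Pi.single i 1, 0) : (Fin (L + 1) → ℝ) × ℝ)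
          + f t • ((0, 1) : (Fin (L + 1) → ℝ) × ℝ) := by
      refine Prod.ext ?_ ?_
      · ext j
        simp [momentCurve, Prod.fst_sum, Finset.sum_apply, Pi.single_apply]
      · simp [momentCurve, Prod.snd_sum]
    rw [hsplit, map_add, map_sum, Polynomial.eval_finsetSum]
    simp_rw [map_smul, Polynomial.eval_monomial, smul_eq_mul, mul_comm]

open scoped Pointwise in
/-- The point `(0, 2 E_L[f])` is a difference of two points in the convex hull of the augmented
moment curve. -/
theorem two_mul_bestApproxErr_mem_sub_convexHull (L : ℕ) {f : ℝ → ℝ} {a b : ℝ} (hab : a ≤ b)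
    (hf : ContinuousOn f (Icc a b)) :
    ((0, 2 * bestApproxErr L f a b) : (Fin (L + 1) → ℝ) × ℝ) ∈
      convexHull ℝ (momentCurve L f '' Icc a b) - convexHull ℝ (momentCurve L f '' Icc a b) := by
  set C := convexHull ℝ (momentCurve L f '' Icc a b)
  have hC : IsCompact C :=
    (isCompact_Icc.image_of_continuousOn
      (continuousOn_momentCurve L hf)).convexHull_of_finiteDimensional
  by_contra hnot
  obtain ⟨g, u, hgu, hu⟩ := geometric_hahn_banach_closed_point
    ((convex_convexHull ℝ _).sub (convex_convexHull ℝ _)) (by simpa only [sub_eq_add_neg] using (hC.add hC.neg).isClosed) hnot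
  obtain ⟨p, hp, hgp⟩ := exists_polynomial_apply_momentCurve L f g
  have hmem : ∀ t ∈ Icc a b, momentCurve L f t ∈ C := fun t ht =>
    subset_convexHull ℝ _ (mem_image_of_mem _ ht)
  have hosc : ∀ x ∈ Icc a b, ∀ y ∈ Icc a b,
      (p.eval x + f x * g (0, 1)) - (p.eval y + f y * g (0, 1)) < u := fun x hx y hy => by
    simpa only [map_sub, hgp] using hgu _ (sub_mem_sub (hmem x hx) (hmem y hy))
  have hu0 : 0 < u := by
    simpa using hosc a (left_mem_Icc.2 hab) a (left_mem_Icc.2 hab)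
  have hval : g (0, 2 * bestApproxErr L f a b) = 2 * bestApproxErr L f a b * g (0, 1) := by
    rw [← smul_eq_mul _ (g (0, 1)), ← map_smul]
    simp
  rw [hval] at hu
  have hE := bestApproxErr_nonneg L f a b
  set c := g (0, 1)
  have hc : 0 < c := by
    by_contra! hc
    nlinarith [mul_nonneg hE (neg_nonneg.2 hc)]
  have hle : 2 * bestApproxErr L f a b ≤ u / c := by
    refine two_mul_bestApproxErr_le_of_oscillation hab hf (Polynomial.C (-c⁻¹) * p)
      ((Polynomial.natDegree_C_mul_le _ _).trans hp) fun x hx y hy => ?_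
    rw [le_div_iff₀ hc, Polynomial.eval_C_mul, Polynomial.eval_C_mul]
    refine le_trans (le_of_eq ?_) (hosc x hx y hy).le
    field_simp
    ring
  rw [le_div_iff₀ hc] at hle
  linarith

theorem moment_matching_measures (η : ℝ) (hη0 : 0 < η) (hη1 : η < 1)
    (L : ℕ) (hL : 0 < L) :
    ∃ ν₀ ν₁ : MeasureTheory.Measure ℝ,
      MeasureTheory.IsProbabilityMeasure ν₀ ∧ MeasureTheory.IsProbabilityMeasure ν₁ ∧
      ν₀ (Set.Icc η 1)ᶜ = 0 ∧ ν₁ (Set.Icc η 1)ᶜ = 0 ∧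
      (∀ l : ℕ, l ≤ L → (∫ t, t ^ l ∂ν₁) = ∫ t, t ^ l ∂ν₀) ∧
      (∫ t, -Real.log t ∂ν₁) - (∫ t, -Real.log t ∂ν₀)
        = 2 * bestApproxErr L (fun x => -Real.log x) η 1 := by
  have hf : ContinuousOn (fun x => -Real.log x) (Icc η 1) :=
    (Real.continuousOn_log.mono fun x hx => (hη0.trans_le hx.1).ne').neg
  obtain ⟨x₁, hx₁, x₀, hx₀, hx⟩ := two_mul_bestApproxErr_mem_sub_convexHull L hη1.le hf
  obtain ⟨ν₁, hν₁, hs₁, hint₁⟩ := exists_probabilityMeasure_of_mem_convexHull_image measurableSet_Icc hx₁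
  obtain ⟨ν₀, hν₀, hs₀, hint₀⟩ := exists_probabilityMeasure_of_mem_convexHull_image measurableSet_Icc hx₀
  refine ⟨ν₀, ν₁, hν₀, hν₁, hs₀, hs₁, fun l hl => ?_, ?_⟩
  · let g : ((Fin (L + 1) → ℝ) × ℝ) →L[ℝ] ℝ :=
      (ContinuousLinearMap.proj (⟨l, Nat.lt_succ_iff.2 hl⟩ : Fin (L + 1))).comp
        (ContinuousLinearMap.fst ℝ _ _)
    have h : g x₁ - g x₀ = 0 := by
      rw [← map_sub]
      simp only [] at hx
      rw [hx]
      rfl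
    rw [← hint₁ g, ← hint₀ g] at h
    exact sub_eq_zero.1 h
  · have h := congrArg Prod.snd hx
    have e₁ := hint₁ (ContinuousLinearMap.snd ℝ _ _)
    have e₀ := hint₀ (ContinuousLinearMap.snd ℝ _ _)
    exact (congrArg₂ _ e₁ e₀).trans h
end

section
/- There exist universal constants D_0 ≥ 1 and c > 0 such that for all positive integers L and all K with K ≥ e·L², the best uniform approximation error of −ln x on [(D_0 K)^{−1}, 1] by polynomials of degree at most L satisfies E_L[−ln x]_{[(D_0 K)^{−1}, 1]} ≥ c·ln(K/L²). -/
open scoped BigOperators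

open Polynomial in
/-- Growth outside `[-1, 1]` of a polynomial bounded on `[-1, 1]`. -/
lemma Polynomial.eval_cosh_le_of_forall_abs_le {n : ℕ} {P : ℝ[X]} {M : ℝ} (hM : 0 < M)
    (hdeg : P.natDegree ≤ n) (hP : ∀ x ∈ Set.Icc (-1 : ℝ) 1, |P.eval x| ≤ M) (t : ℝ) :
    P.eval (Real.cosh t) ≤ M * Real.cosh (n * t) := by
  have hscaled := Chebyshev.eval_iterate_derivative_le_of_forall_abs_le_one
    (n := n) (P := C M⁻¹ * P) (k := 0) (Real.one_le_cosh t)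
    (natDegree_le_iff_degree_le.mp ((natDegree_C_mul_le _ _).trans hdeg))
    (fun x hx => by
      rw [eval_mul, eval_C, abs_mul, abs_of_pos (inv_pos.mpr hM), inv_mul_le_one₀ hM]
      exact hP x hx)
  simp only [Function.iterate_zero, id_eq, eval_mul, eval_C, Chebyshev.T_real_cosh] at hscaled
  rwa [inv_mul_le_iff₀ hM, Int.cast_natCast] at hscaled

lemma Real.one_add_sq_div_two_le_cosh {t : ℝ} (ht : 0 ≤ t) : 1 + t ^ 2 / 2 ≤ Real.cosh t := by
  have hsinh : t / 2 ≤ Real.sinh (t / 2) := Real.self_le_sinh_iff.mpr (by positivity)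
  have hdouble := Real.cosh_two_mul (t / 2)
  rw [mul_div_cancel₀ t two_ne_zero] at hdouble
  nlinarith [Real.cosh_sq (t / 2)]

lemma Real.cosh_one_le_three : Real.cosh 1 ≤ 3 := by
  rw [Real.cosh_eq]
  linarith [Real.exp_one_lt_d9, Real.exp_le_one_iff.mpr (show (-1 : ℝ) ≤ 0 by norm_num)]

lemma abs_sub_eval_le_uniformErr {f : ℝ → ℝ} {a b x : ℝ} (hf : ContinuousOn f (Set.Icc a b))
    (q : Polynomial ℝ) (hx : x ∈ Set.Icc a b) : |f x - q.eval x| ≤ uniformErr f a b q :=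
  le_csSup (isCompact_Icc.bddAbove_image (hf.sub q.continuousOn).abs) ⟨x, hx, rfl⟩

open Polynomial in
/-- If `q` approximates `-log` on `[a, 1]` up to `ε`, then `q(x) - q(ρ x) - log ρ` is small on
`[a, ρ⁻¹]` but equals `-log ρ` at `0`; this bounds `log ρ`. -/
lemma log_le_of_forall_abs_neg_log_sub_eval_le {q : ℝ[X]} {L : ℕ} {a ρ t ε : ℝ}
    (hq : q.natDegree ≤ L) (ha : 0 < a) (hρ : 1 ≤ ρ) (hε : 0 < ε)
    (hat : a * ρ * (Real.cosh t + 1) ≤ Real.cosh t - 1)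
    (happrox : ∀ x ∈ Set.Icc a 1, |-Real.log x - q.eval x| ≤ ε) :
    Real.log ρ ≤ 2 * ε * Real.cosh (L * t) := by
  have hρ₀ : 0 < ρ := by linarith
  have hcosh := Real.one_le_cosh t
  set h : ℝ := (ρ * (Real.cosh t + 1))⁻¹ with hh
  have hpos : 0 < h := by positivity
  have hmul : ρ * (h * (Real.cosh t + 1)) = 1 := by rw [hh]; field_simp
  have hleft : a ≤ h * (Real.cosh t - 1) := by
    calc a = h * (a * ρ * (Real.cosh t + 1)) := by linear_combination (-a) * hmul
      _ ≤ h * (Real.cosh t - 1) := by gcongr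
  let s : ℝ[X] := C (h * Real.cosh t) - C h * X
  have hs : s.natDegree ≤ 1 := by
    simp only [s]; compute_degree
  have hseval (y : ℝ) : s.eval y = h * (Real.cosh t - y) := by
    simp [s, mul_sub]
  let P : ℝ[X] := C (Real.log ρ) - (q.comp s - q.comp (C ρ * s))
  have hcomp {r : ℝ[X]} (hr : r.natDegree ≤ 1) : (q.comp r).natDegree ≤ L :=
    natDegree_comp_le.trans ((Nat.mul_le_mul hq hr).trans_eq (mul_one L))
  have hPdeg : P.natDegree ≤ L :=
    (natDegree_sub_le_of_le (natDegree_C _).le (natDegree_sub_le_of_le (hcomp hs)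
      (hcomp ((natDegree_C_mul_le _ _).trans hs)))).trans (by simp)
  have hbound : ∀ y ∈ Set.Icc (-1 : ℝ) 1, |P.eval y| ≤ 2 * ε := by
    intro y hy
    have hlow : a ≤ s.eval y := hleft.trans (by rw [hseval]; gcongr; exact hy.2)
    have hhigh : ρ * s.eval y ≤ 1 := by
      rw [hseval, ← hmul]; gcongr; linarith [hy.1]
    have hspos : 0 < s.eval y := ha.trans_le hlow
    have hscale : s.eval y ≤ ρ * s.eval y := le_mul_of_one_le_left hspos.le hρ
    have h₁ := happrox _ ⟨hlow, hscale.trans hhigh⟩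
    have h₂ := happrox _ ⟨hlow.trans hscale, hhigh⟩
    rw [Real.log_mul hρ₀.ne' hspos.ne'] at h₂
    have hP : P.eval y = Real.log ρ - (q.eval (s.eval y) - q.eval (ρ * s.eval y)) := by
      simp [P, eval_comp]
    rw [hP]
    rw [abs_le] at h₁ h₂ ⊢
    constructor <;> linarith [h₁.1, h₁.2, h₂.1, h₂.2]
  have hvalue : P.eval (Real.cosh t) = Real.log ρ := by
    simp [P, eval_comp, hseval]
  rw [← hvalue]
  exact eval_cosh_le_of_forall_abs_le (by positivity) hPdeg hbound t

theorem log_approx_lower_bound :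
    ∃ (D₀ c : ℝ), 1 ≤ D₀ ∧ 0 < c ∧
      ∀ (L : ℕ) (K : ℝ), 0 < L → Real.exp 1 * (L : ℝ) ^ 2 ≤ K →
        c * Real.log (K / (L : ℝ) ^ 2)
          ≤ bestApproxErr L (fun x => -Real.log x) (D₀ * K)⁻¹ 1 := by
  have hC : 0 < Real.cosh 1 := Real.cosh_pos 1
  refine ⟨8, (3 * Real.cosh 1)⁻¹, by norm_num, by positivity, fun L K hL hK => ?_⟩
  have hL₀ : (0 : ℝ) < L := by exact_mod_cast hL
  have hL₁ : (1 : ℝ) ≤ L := by exact_mod_cast hL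
  have hexp : Real.exp 1 ≤ K / (L : ℝ) ^ 2 := by rwa [le_div_iff₀ (by positivity)]
  have hK₀ : 0 < K := lt_of_lt_of_le (by positivity) hK
  have hlog : 0 < Real.log (K / (L : ℝ) ^ 2) :=
    Real.log_pos ((Real.one_lt_exp_iff.mpr one_pos).trans_le hexp)
  refine le_csInf ⟨_, 0, by simp, rfl⟩ ?_
  rintro _ ⟨q, hq, rfl⟩
  by_contra! hlt
  have ha : 0 < (8 * K)⁻¹ := by positivity
  have hcont : ContinuousOn (fun x => -Real.log x) (Set.Icc (8 * K)⁻¹ 1) :=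
    (Real.continuousOn_log.mono fun x hx => (ha.trans_le hx.1).ne').neg
  have hcosh_le : Real.cosh (1 / L) ≤ 3 := by
    refine le_trans ?_ Real.cosh_one_le_three
    rw [Real.cosh_le_cosh, abs_of_pos (by positivity), abs_one]
    exact div_le_one_of_le₀ hL₁ hL₀.le
  have hnode : (8 * K)⁻¹ * (K / (L : ℝ) ^ 2) * (Real.cosh (1 / L) + 1)
      ≤ Real.cosh (1 / L) - 1 := by
    have hquad := Real.one_add_sq_div_two_le_cosh (t := 1 / (L : ℝ)) (by positivity)
    calc (8 * K)⁻¹ * (K / (L : ℝ) ^ 2) * (Real.cosh (1 / L) + 1)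
        ≤ (8 * K)⁻¹ * (K / (L : ℝ) ^ 2) * (3 + 1) := by gcongr
      _ = (1 / (L : ℝ)) ^ 2 / 2 := by field_simp; norm_num
      _ ≤ Real.cosh (1 / L) - 1 := by linarith
  have hle := log_le_of_forall_abs_neg_log_sub_eval_le hq ha
    ((Real.one_le_exp zero_le_one).trans hexp)
    (ε := (3 * Real.cosh 1)⁻¹ * Real.log (K / (L : ℝ) ^ 2)) (by positivity) hnode
    fun x hx => (abs_sub_eval_le_uniformErr hcont q hx).trans hlt.le
  rw [mul_one_div_cancel hL₀.ne'] at hle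
  have hthird : 2 * ((3 * Real.cosh 1)⁻¹ * Real.log (K / (L : ℝ) ^ 2)) * Real.cosh 1
      = 2 / 3 * Real.log (K / (L : ℝ) ^ 2) := by field_simp
  linarith
end

section
/- Let P = (p_1, …, p_S) be a discrete probability distribution and let t ∈ (0, e^{−1}]. Then the number of indices i with p_i > t satisfies |{i : p_i > t}| ≤ 1 + H(P)/(t ln(1/t)), where H(P) = ∑_{i=1}^S −p_i ln p_i. -/
open scoped BigOperators

/-- `x ↦ -x log x` is monotone on `(0, e⁻¹]`. -/
lemma negMulLog_le_of_le_exp_inv {t x : ℝ} (ht : 0 < t) (htx : t ≤ x)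
    (hx : x ≤ (Real.exp 1)⁻¹) : -(t * Real.log t) ≤ -(x * Real.log x) := by
  have hx0 : 0 < x := ht.trans_le htx
  have hlog : Real.log x ≤ -1 := by
    have h := Real.log_le_log hx0 hx
    rwa [Real.log_inv, Real.log_exp] at h
  have hdiv : t * (Real.log x - Real.log t) ≤ x - t := by
    have h := Real.log_le_sub_one_of_pos (div_pos hx0 ht)
    rw [Real.log_div hx0.ne' ht.ne'] at h
    calc t * (Real.log x - Real.log t) ≤ t * (x / t - 1) :=
          mul_le_mul_of_nonneg_left h ht.le
      _ = x - t := by field_simp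
  nlinarith [mul_nonneg (sub_nonneg.2 htx) (by linarith : 0 ≤ -1 - Real.log x)]

/-- On `[e⁻¹, 1 - e⁻¹]`, `-x log x` is at least half of its maximum `e⁻¹`. -/
lemma half_exp_inv_le_negMulLog {x : ℝ} (hx : (Real.exp 1)⁻¹ ≤ x)
    (hx' : x ≤ 1 - (Real.exp 1)⁻¹) : (Real.exp 1)⁻¹ / 2 ≤ -(x * Real.log x) := by
  have ha : 0 < (Real.exp 1)⁻¹ := inv_pos.2 (Real.exp_pos 1)
  have hx0 : 0 < x := ha.trans_le hx
  have hlog := mul_le_mul_of_nonneg_left (Real.log_le_sub_one_of_pos hx0) hx0.le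
  nlinarith [mul_nonneg (sub_nonneg.2 hx) (sub_nonneg.2 hx')]

/-- The atoms exceeding `e⁻¹` have total entropy at least `c` times their number minus one,
for every `0 ≤ c ≤ e⁻¹`. -/
lemma card_sub_one_mul_le_sum_negMulLog {ι : Type*} (B : Finset ι) (p : ι → ℝ)
    (hB : ∀ i ∈ B, (Real.exp 1)⁻¹ < p i) (hsum : ∑ i ∈ B, p i ≤ 1)
    {c : ℝ} (hc0 : 0 ≤ c) (hc : c ≤ (Real.exp 1)⁻¹) :
    ((B.card : ℝ) - 1) * c ≤ ∑ i ∈ B, -(p i * Real.log (p i)) := by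
  classical
  have ha : 0 < (Real.exp 1)⁻¹ := inv_pos.2 (Real.exp_pos 1)
  have hp : ∀ i ∈ B, 0 ≤ p i := fun i hi => ha.le.trans (hB i hi).le
  rcases Nat.lt_or_ge 1 B.card with h2 | h1
  · have hcard : (B.card : ℝ) ≤ 2 := by
      have h := Finset.card_nsmul_le_sum B p _ fun i hi => (hB i hi).le
      have h3 : (3 : ℝ)⁻¹ < (Real.exp 1)⁻¹ :=
        inv_strictAnti₀ (Real.exp_pos 1) Real.exp_one_lt_three
      rw [nsmul_eq_mul] at h
      by_contra! hlt
      have h4 : (3 : ℝ) ≤ B.card := by exact_mod_cast (by exact_mod_cast hlt : 2 < B.card)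
      nlinarith
    have hterm : ∀ i ∈ B, c / 2 ≤ -(p i * Real.log (p i)) := by
      intro i hi
      obtain ⟨j, hj, hji⟩ := Finset.exists_mem_ne h2 i
      have hpair : p j + p i ≤ ∑ k ∈ B, p k := by
        rw [← Finset.sum_pair hji]
        refine Finset.sum_le_sum_of_subset_of_nonneg ?_ fun k hk _ => hp k hk
        intro k hk
        rcases Finset.mem_insert.1 hk with rfl | hk
        · exact hj
        · rwa [Finset.mem_singleton.1 hk]
      have h := half_exp_inv_le_negMulLog (hB i hi).le (by linarith [hB j hj])
      linarith
    have h := Finset.card_nsmul_le_sum B _ _ hterm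
    rw [nsmul_eq_mul] at h
    nlinarith
  · have hcard : (B.card : ℝ) ≤ 1 := by exact_mod_cast h1
    refine (mul_nonpos_of_nonpos_of_nonneg (by linarith) hc0).trans
      (Finset.sum_nonneg fun i hi => ?_)
    have hle : p i ≤ 1 := (Finset.single_le_sum hp hi).trans hsum
    exact neg_nonneg.2 (mul_nonpos_of_nonneg_of_nonpos (hp i hi)
      (Real.log_nonpos (hp i hi) hle))

theorem card_large_atoms_le (S : ℕ) (p : Fin S → ℝ)
    (hp : ∀ i, 0 ≤ p i) (hsum : ∑ i, p i = 1)
    (t : ℝ) (ht0 : 0 < t) (ht1 : t ≤ (Real.exp 1)⁻¹) :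
    ((Finset.univ.filter (fun i => t < p i)).card : ℝ)
      ≤ 1 + (∑ i, -(p i * Real.log (p i))) / (t * Real.log (1 / t)) := by
  have hlogt : Real.log t ≤ -1 := by
    have h := Real.log_le_log ht0 ht1
    rwa [Real.log_inv, Real.log_exp] at h
  have hct : t * Real.log (1 / t) = -(t * Real.log t) := by
    rw [one_div, Real.log_inv, mul_neg]
  have hc : 0 < -(t * Real.log t) := by nlinarith
  have hce : -(t * Real.log t) ≤ (Real.exp 1)⁻¹ := by
    have h := negMulLog_le_of_le_exp_inv ht0 ht1 le_rfl
    rwa [Real.log_inv, Real.log_exp, mul_neg, mul_one, neg_neg] at h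
  have hle : ∀ i, p i ≤ 1 := fun i =>
    hsum ▸ Finset.single_le_sum (fun j _ => hp j) (Finset.mem_univ i)
  have hnn : ∀ i, 0 ≤ -(p i * Real.log (p i)) := fun i =>
    neg_nonneg.2 (mul_nonpos_of_nonneg_of_nonpos (hp i) (Real.log_nonpos (hp i) (hle i)))
  rw [hct, ← sub_le_iff_le_add', le_div_iff₀ hc]
  set L := Finset.univ.filter (fun i => t < p i) with hL
  have hbig := card_sub_one_mul_le_sum_negMulLog
    (L.filter fun i => (Real.exp 1)⁻¹ < p i) p (fun i hi => (Finset.mem_filter.1 hi).2)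
    (hsum ▸ Finset.sum_le_sum_of_subset_of_nonneg (Finset.subset_univ _) fun i _ _ => hp i)
    hc.le hce
  have hsmall : ((L.filter fun i => ¬ (Real.exp 1)⁻¹ < p i).card : ℝ) * -(t * Real.log t)
      ≤ ∑ i ∈ L.filter (fun i => ¬ (Real.exp 1)⁻¹ < p i), -(p i * Real.log (p i)) := by
    rw [← nsmul_eq_mul]
    refine Finset.card_nsmul_le_sum _ _ _ fun i hi => ?_
    obtain ⟨hiL, hi⟩ := Finset.mem_filter.1 hi
    exact negMulLog_le_of_le_exp_inv ht0 (Finset.mem_filter.1 hiL).2.le (not_lt.1 hi)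
  have hsplit := Finset.sum_filter_add_sum_filter_not L
    (fun i => (Real.exp 1)⁻¹ < p i) fun i => -(p i * Real.log (p i))
  have hcard : ((L.filter fun i => (Real.exp 1)⁻¹ < p i).card : ℝ)
      + (L.filter fun i => ¬ (Real.exp 1)⁻¹ < p i).card = L.card := by
    exact_mod_cast Finset.card_filter_add_card_filter_not (s := L) _
  have hsub : ∑ i ∈ L, -(p i * Real.log (p i)) ≤ ∑ i, -(p i * Real.log (p i)) :=
    Finset.sum_le_sum_of_subset_of_nonneg (Finset.subset_univ _) fun i _ _ => hnn i
  rw [← hcard]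
  linarith
end
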